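/- Let d > 0 be a squarefree integer, let 𝓞 be the ring of integers of the real quadratic field ℚ(√d), and let G = PSL(2,𝓞). Then the abelianization G/[G,G] is finite, every rational prime q dividing |G/[G,G]| is ramified or split in 𝓞 and satisfies q ∈ {2,3}; in particular |G/[G,G]| = 2^a·3^b for some natural numbers a, b. -/

import Mathlib

set_option linter.unusedSectionVars false

open NumberField Matrix

instance : Fact (Even (Fintype.card (Fin 2))) := ⟨⟨1, rfl⟩⟩

variable (K : Type*) [Field K] [NumberField K]

/-- The subgroup `{±I}` of `SL(2, 𝓞)`, generated by `-I`. -/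
def PM : Subgroup (Matrix.SpecialLinearGroup (Fin 2) (𝓞 K)) :=
  Subgroup.closure {(-1 : Matrix.SpecialLinearGroup (Fin 2) (𝓞 K))}

theorem PM_le_center : PM K ≤ Subgroup.center (Matrix.SpecialLinearGroup (Fin 2) (𝓞 K)) := by
  rw [PM, Subgroup.closure_le]
  rintro x rfl
  rw [SetLike.mem_coe, Subgroup.mem_center_iff]
  intro g
  ext i j
  simp [Matrix.SpecialLinearGroup.coe_mul]

instance PM_normal : (PM K).Normal := by
  constructor
  intro n hn g
  have hc := PM_le_center K hn
  rw [Subgroup.mem_center_iff] at hc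
  rw [hc g, mul_assoc, mul_inv_cancel, mul_one]
  exact hn

/-- `PSL(2, 𝓞)`, the quotient of `SL(2, 𝓞)` by `{±I}`. -/
def PSL := Matrix.SpecialLinearGroup (Fin 2) (𝓞 K) ⧸ PM K

instance : Group (PSL K) := QuotientGroup.Quotient.group (PM K)

/-- The projection `SL(2, 𝓞) → PSL(2, 𝓞)`. -/
def proj : Matrix.SpecialLinearGroup (Fin 2) (𝓞 K) →* PSL K :=
  QuotientGroup.mk' (PM K)

/-- The elementary matrix `T_x = [[1, x], [0, 1]]` in `SL(2, 𝓞)`. -/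
def T (x : 𝓞 K) : Matrix.SpecialLinearGroup (Fin 2) (𝓞 K) :=
  ⟨!![1, x; 0, 1], by simp [Matrix.det_fin_two_of]⟩

/-- The reduction homomorphism `SL(2, 𝓞) → SL(2, 𝓞/π)`. -/
def red (π : Ideal (𝓞 K)) :
    Matrix.SpecialLinearGroup (Fin 2) (𝓞 K) →*
      Matrix.SpecialLinearGroup (Fin 2) ((𝓞 K) ⧸ π) :=
  Matrix.SpecialLinearGroup.map (Ideal.Quotient.mk π)

/-- The principal congruence subgroup `Ḡ(π)` of `PSL(2,𝓞)` : the image in `PSL(2,𝓞)` of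
`{A ∈ SL(2,𝓞) : A ≡ ±I (mod π)}`, the set of matrices reducing to `±I` modulo `π`. -/
def Gbar (π : Ideal (𝓞 K)) : Subgroup (PSL K) :=
  Subgroup.map (proj K)
    (Subgroup.comap (red K π)
      (Subgroup.closure {(-1 : Matrix.SpecialLinearGroup (Fin 2) ((𝓞 K) ⧸ π))}))

/-- A subgroup of `G = PSL(2,𝓞)` is a congruence subgroup if it contains `Ḡ(π)` for some
nonzero ideal `π` of `𝓞`. -/
def IsCongruence (H : Subgroup (PSL K)) : Prop :=
  ∃ π : Ideal (𝓞 K), π ≠ ⊥ ∧ Gbar K π ≤ H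

/-- The normal closure in `PSL(2,𝓞)` of the images of the matrices `T_{mx}`, `x ∈ 𝓞`. -/
def TclosureP (m : ℕ) : Subgroup (PSL K) :=
  Subgroup.normalClosure {x : PSL K | ∃ a : 𝓞 K, x = proj K (T K ((m : 𝓞 K) * a))}

/-- `H ≤ PSL(2,𝓞)` has level `m` : `m` is the smallest positive integer such that the
normal closure in `PSL(2,𝓞)` of the images of `{T_{mx} : x ∈ 𝓞}` is contained in `H`. -/
def HasLevelP (H : Subgroup (PSL K)) (m : ℕ) : Prop :=
  0 < m ∧ TclosureP K m ≤ H ∧ ∀ k : ℕ, 0 < k → TclosureP K k ≤ H → m ≤ k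

/-- A rational prime `q` is split in `𝓞` if `q𝓞` is a product of at least two distinct
prime ideals, each occurring with multiplicity one; equivalently `q𝓞` is squarefree and
not itself prime. -/
def Split (q : ℕ) : Prop :=
  Squarefree (Ideal.span {(q : 𝓞 K)}) ∧ ¬(Ideal.span {(q : 𝓞 K)}).IsPrime

/-- A rational prime `q` is ramified in `𝓞` if some prime ideal divides `q𝓞` with
multiplicity at least `2`, i.e. `q𝓞` is not squarefree. -/
def Ramified (q : ℕ) : Prop := ¬ Squarefree (Ideal.span {(q : 𝓞 K)})

namespace SL2

section Elementary

variable {S : Type*} [CommRing S]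

theorem ext4 {g h : SpecialLinearGroup (Fin 2) S} (h00 : g 0 0 = h 0 0) (h01 : g 0 1 = h 0 1)
    (h10 : g 1 0 = h 1 0) (h11 : g 1 1 = h 1 1) : g = h := by
  ext i j
  fin_cases i <;> fin_cases j <;> assumption

@[simp] theorem mul00 (g h : SpecialLinearGroup (Fin 2) S) :
    (g * h) 0 0 = g 0 0 * h 0 0 + g 0 1 * h 1 0 := by
  simp [Matrix.mul_apply, Fin.sum_univ_two]

@[simp] theorem mul01 (g h : SpecialLinearGroup (Fin 2) S) :
    (g * h) 0 1 = g 0 0 * h 0 1 + g 0 1 * h 1 1 := by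
  simp [Matrix.mul_apply, Fin.sum_univ_two]

@[simp] theorem mul10 (g h : SpecialLinearGroup (Fin 2) S) :
    (g * h) 1 0 = g 1 0 * h 0 0 + g 1 1 * h 1 0 := by
  simp [Matrix.mul_apply, Fin.sum_univ_two]

@[simp] theorem mul11 (g h : SpecialLinearGroup (Fin 2) S) :
    (g * h) 1 1 = g 1 0 * h 0 1 + g 1 1 * h 1 1 := by
  simp [Matrix.mul_apply, Fin.sum_univ_two]

@[simp] theorem inv00 (g : SpecialLinearGroup (Fin 2) S) : g⁻¹ 0 0 = g 1 1 := by
  simp [adjugate_fin_two]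

@[simp] theorem inv01 (g : SpecialLinearGroup (Fin 2) S) : g⁻¹ 0 1 = -g 0 1 := by
  simp [adjugate_fin_two]

@[simp] theorem inv10 (g : SpecialLinearGroup (Fin 2) S) : g⁻¹ 1 0 = -g 1 0 := by
  simp [adjugate_fin_two]

@[simp] theorem inv11 (g : SpecialLinearGroup (Fin 2) S) : g⁻¹ 1 1 = g 0 0 := by
  simp [adjugate_fin_two]

theorem det_eq (g : SpecialLinearGroup (Fin 2) S) : g 0 0 * g 1 1 - g 0 1 * g 1 0 = 1 := by
  have := g.2
  rwa [det_fin_two] at this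

/-- The matrix `[[a, b], [c, d]]` of determinant one. -/
def mk4 (a b c d : S) (h : a * d - b * c = 1) : SpecialLinearGroup (Fin 2) S :=
  ⟨!![a, b; c, d], by rw [det_fin_two_of, h]⟩

section
variable (a b c d : S) (h : a * d - b * c = 1)
@[simp] theorem mk4_00 : mk4 a b c d h 0 0 = a := rfl
@[simp] theorem mk4_01 : mk4 a b c d h 0 1 = b := rfl
@[simp] theorem mk4_10 : mk4 a b c d h 1 0 = c := rfl
@[simp] theorem mk4_11 : mk4 a b c d h 1 1 = d := rfl
end

/-- Upper unipotent matrices. -/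
def up (x : S) : SpecialLinearGroup (Fin 2) S := mk4 1 x 0 1 (by ring)

/-- Lower unipotent matrices. -/
def lo (x : S) : SpecialLinearGroup (Fin 2) S := mk4 1 0 x 1 (by ring)

/-- The Weyl element. -/
def wy : SpecialLinearGroup (Fin 2) S := mk4 0 1 (-1) 0 (by ring)

/-- Diagonal matrices. -/
def dia (u : Sˣ) : SpecialLinearGroup (Fin 2) S := mk4 u 0 0 (u⁻¹ : Sˣ) (by simp)

@[simp] theorem up00 (x : S) : up x 0 0 = 1 := rfl
@[simp] theorem up01 (x : S) : up x 0 1 = x := rfl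
@[simp] theorem up10 (x : S) : up x 1 0 = 0 := rfl
@[simp] theorem up11 (x : S) : up x 1 1 = 1 := rfl
@[simp] theorem lo00 (x : S) : lo x 0 0 = 1 := rfl
@[simp] theorem lo01 (x : S) : lo x 0 1 = 0 := rfl
@[simp] theorem lo10 (x : S) : lo x 1 0 = x := rfl
@[simp] theorem lo11 (x : S) : lo x 1 1 = 1 := rfl
@[simp] theorem wy00 : (wy : SpecialLinearGroup (Fin 2) S) 0 0 = 0 := rfl
@[simp] theorem wy01 : (wy : SpecialLinearGroup (Fin 2) S) 0 1 = 1 := rfl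
@[simp] theorem wy10 : (wy : SpecialLinearGroup (Fin 2) S) 1 0 = -1 := rfl
@[simp] theorem wy11 : (wy : SpecialLinearGroup (Fin 2) S) 1 1 = 0 := rfl
@[simp] theorem dia00 (u : Sˣ) : dia u 0 0 = u := rfl
@[simp] theorem dia01 (u : Sˣ) : dia u 0 1 = 0 := rfl
@[simp] theorem dia10 (u : Sˣ) : dia u 1 0 = 0 := rfl
@[simp] theorem dia11 (u : Sˣ) : dia u 1 1 = (u⁻¹ : Sˣ) := rfl

theorem up_add (x y : S) : up (x + y) = up x * up y := by
  apply ext4 <;> simp [add_comm]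

theorem up_zero : up (0 : S) = 1 := by
  apply ext4 <;> simp

theorem up_inv (x : S) : (up x)⁻¹ = up (-x) := by
  apply ext4 <;> simp

theorem lo_inv (x : S) : (lo x)⁻¹ = lo (-x) := by
  apply ext4 <;> simp

theorem lo_eq_conj (x : S) : lo x = wy * up (-x) * wy⁻¹ := by
  apply ext4 <;> simp

theorem dia_mul (u v : Sˣ) : dia (u * v) = dia u * dia v := by
  apply ext4 <;> simp [mul_comm]

/-- Diagonal matrices as a homomorphism. -/
def diaHom : Sˣ →* SpecialLinearGroup (Fin 2) S where
  toFun := dia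
  map_one' := by apply ext4 <;> simp
  map_mul' := dia_mul

theorem dia_conj_up (u : Sˣ) (x : S) : dia u * up x * (dia u)⁻¹ = up (u * x * u) := by
  apply ext4 <;> simp

theorem dia_conj_lo (u : Sˣ) (x : S) :
    dia u * lo x * (dia u)⁻¹ = lo (x * ((u⁻¹ : Sˣ) * (u⁻¹ : Sˣ))) := by
  apply ext4 <;> simp; ring

/-- The principal congruence subgroup of level `m`. -/
def cong (m : S) : Subgroup (SpecialLinearGroup (Fin 2) S) :=
  (SpecialLinearGroup.map (Ideal.Quotient.mk (Ideal.span {m}))).ker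

instance (m : S) : (cong m).Normal := by
  unfold cong
  infer_instance

theorem mem_cong {m : S} {g : SpecialLinearGroup (Fin 2) S} :
    g ∈ cong m ↔ m ∣ g 0 0 - 1 ∧ m ∣ g 0 1 ∧ m ∣ g 1 0 ∧ m ∣ g 1 1 - 1 := by
  rw [cong, MonoidHom.mem_ker]
  simp only [← Ideal.mem_span_singleton, ← Ideal.Quotient.eq_zero_iff_mem, map_sub, map_one,
    sub_eq_zero]
  constructor
  · intro h
    have h' : ∀ i j, (SpecialLinearGroup.map (Ideal.Quotient.mk (Ideal.span {m})) g) i j =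
        (1 : SpecialLinearGroup (Fin 2) (S ⧸ Ideal.span {m})) i j := fun i j ↦ by rw [h]
    exact ⟨by simpa using h' 0 0, by simpa using h' 0 1, by simpa using h' 1 0,
      by simpa using h' 1 1⟩
  · rintro ⟨h1, h2, h3, h4⟩
    apply ext4 <;> simp [*]

theorem cong_anti {m n : S} (h : m ∣ n) : cong n ≤ cong m := by
  intro g hg
  rw [mem_cong] at *
  exact ⟨h.trans hg.1, h.trans hg.2.1, h.trans hg.2.2.1, h.trans hg.2.2.2⟩

/-- The subgroup generated by the elementary matrices of level `m`. -/
def elem (m : S) : Subgroup (SpecialLinearGroup (Fin 2) S) :=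
  Subgroup.closure ({g | ∃ x, g = up (m * x)} ∪ {g | ∃ x, g = lo (m * x)})

theorem up_mem_elem {m x : S} (h : m ∣ x) : up x ∈ elem m := by
  obtain ⟨y, rfl⟩ := h
  exact Subgroup.subset_closure (Or.inl ⟨y, rfl⟩)

theorem lo_mem_elem {m x : S} (h : m ∣ x) : lo x ∈ elem m := by
  obtain ⟨y, rfl⟩ := h
  exact Subgroup.subset_closure (Or.inr ⟨y, rfl⟩)

theorem elem_le {m : S} {H : Subgroup (SpecialLinearGroup (Fin 2) S)}
    (h1 : ∀ x, up (m * x) ∈ H) (h2 : ∀ x, lo (m * x) ∈ H) : elem m ≤ H := by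
  rw [elem, Subgroup.closure_le]
  rintro g (⟨x, rfl⟩ | ⟨x, rfl⟩)
  exacts [h1 x, h2 x]

theorem elem_le_cong (m : S) : elem m ≤ cong m :=
  elem_le (fun x ↦ by simp [mem_cong]) (fun x ↦ by simp [mem_cong])

theorem dia_conj_elem {m : S} (u : Sˣ) {g : SpecialLinearGroup (Fin 2) S} (hg : g ∈ elem m) :
    dia u * g * (dia u)⁻¹ ∈ elem m := by
  have : elem m ≤ (elem m).comap (MulAut.conj (dia u)).toMonoidHom := by
    refine elem_le (fun x ↦ ?_) (fun x ↦ ?_)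
    · change dia u * up (m * x) * (dia u)⁻¹ ∈ elem m
      rw [dia_conj_up]
      exact up_mem_elem ⟨u * x * u, by ring⟩
    · change dia u * lo (m * x) * (dia u)⁻¹ ∈ elem m
      rw [dia_conj_lo]
      exact lo_mem_elem ⟨_, mul_assoc _ _ _⟩
  exact this hg

theorem exists_eq_lo_mul {m : S} {g h : SpecialLinearGroup (Fin 2) S} (hg : g ∈ cong m)
    (hh : h ∈ cong m) (h0 : g 0 0 = h 0 0) (h1 : g 0 1 = h 0 1) :
    ∃ X ∈ elem m, h = X * g := by
  refine ⟨lo (h 1 0 * g 1 1 - h 1 1 * g 1 0), lo_mem_elem ?_, ?_⟩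
  · exact dvd_sub ((mem_cong.1 hh).2.2.1.mul_right _) ((mem_cong.1 hg).2.2.1.mul_left _)
  · have dg := det_eq g
    have dh := det_eq h
    apply ext4 <;> simp
    · exact h0.symm
    · exact h1.symm
    · rw [← h0, ← h1] at dh
      linear_combination (-h 1 0) * dg + g 1 0 * dh
    · rw [← h0, ← h1] at dh
      linear_combination (-h 1 1) * dg + g 1 1 * dh

theorem elem_le_ker {A : Type*} [CommGroup A] (φ : SpecialLinearGroup (Fin 2) S →* A) (u : Sˣ)
    {m : S} (hm : (u : S) * u - 1 ∣ m) : elem m ≤ φ.ker := by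
  have key : ∀ x, m ∣ x → φ (up x) = 1 := by
    rintro _ ⟨y, rfl⟩
    obtain ⟨v, rfl⟩ := hm
    have h := congrArg φ (dia_conj_up u (v * y))
    rw [map_mul, map_mul, map_inv, mul_comm, inv_mul_cancel_left] at h
    have e : ((u : S) * u - 1) * v * y = u * (v * y) * u + -(v * y) := by ring
    rw [e, up_add, ← up_inv, map_mul, map_inv, h, mul_inv_cancel]
  refine elem_le (fun x ↦ key _ ⟨x, rfl⟩) (fun x ↦ ?_)
  rw [MonoidHom.mem_ker, lo_eq_conj, map_mul, map_mul, map_inv, key _ ⟨-x, by ring⟩, mul_one,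
    mul_inv_cancel]

end Elementary

section Integers

theorem exists_dvd_add_mul_sub (s t : ℤ) {n w : ℤ} (h : IsCoprime n w) (hn : n ≠ 0) (hw : w ≠ 0) :
    ∃ j, w ∣ s + n * j - t ∧ s + n * j ≠ 0 := by
  obtain ⟨x, y, hxy⟩ := h
  have key : ∀ i, w ∣ s + n * ((t - s) * x + w * i) - t := fun i ↦
    ⟨n * i - (t - s) * y, by linear_combination (t - s) * hxy⟩
  by_cases h0 : s + n * ((t - s) * x + w * 0) = 0
  · refine ⟨_, key 1, fun h1 ↦ mul_ne_zero hn hw ?_⟩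
    linear_combination h1 - h0
  · exact ⟨_, key 0, h0⟩

theorem exists_isCoprime_add_mul {r n s : ℤ} (hn : n ≠ 0) (hs : s ≠ 0)
    (h : ∀ q : ℤ, Prime q → q ∣ r → q ∣ n → ¬ q ∣ s) (B : ℤ) :
    ∃ k, IsCoprime (r + n * k) s ∧ B < r + n * k := by
  have hg : 0 < Int.gcd r n := Int.gcd_pos_of_ne_zero_right _ hn
  obtain ⟨r', hr'⟩ := Int.gcd_dvd_left r n
  obtain ⟨n', hn'⟩ := Int.gcd_dvd_right r n
  obtain ⟨g, hgdef⟩ : ∃ g : ℤ, g = Int.gcd r n := ⟨_, rfl⟩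
  have hg0 : 0 < g := by
    rw [hgdef]
    exact_mod_cast hg
  rw [← hgdef] at hr' hn'
  have hcop : IsCoprime r' n' := by
    obtain ⟨x, y, hxy⟩ := (Int.gcd_dvd_iff (a := r) (b := n) (n := Int.gcd r n)).1 dvd_rfl
    rw [← hgdef] at hxy
    refine ⟨x, y, mul_left_cancel₀ hg0.ne' ?_⟩
    linear_combination (-x) * hr' - y * hn' - hxy
  have hn0 : n' ≠ 0 := by
    rintro rfl
    exact hn (by rw [hn', mul_zero])
  obtain ⟨p, hpgt, hp, hpm⟩ := Nat.forall_exists_prime_gt_and_zmodEq (max B.natAbs s.natAbs)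
    (q := n'.natAbs) (a := r') (Int.natAbs_ne_zero.2 hn0)
    (by rwa [Int.natCast_natAbs, IsCoprime.abs_right_iff])
  have hdvd : n' ∣ (p : ℤ) - r' := by
    have := (Int.modEq_iff_dvd.1 hpm.symm)
    exact Int.natAbs_dvd.1 this
  obtain ⟨k, hk⟩ := hdvd
  have e : r + n * k = g * p := by
    linear_combination hr' + k * hn' - g * hk
  have hBp : (B.natAbs : ℤ) < p := by exact_mod_cast (lt_of_le_of_lt (le_max_left _ _) hpgt)
  refine ⟨k, ?_, ?_⟩
  · rw [e]
    refine IsCoprime.mul_left ?_ ?_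
    · refine isCoprime_of_prime_dvd (fun hh ↦ hs hh.2) fun q hq hqg hqs ↦ ?_
      exact h q hq (hqg.trans ⟨_, hr'⟩) (hqg.trans ⟨_, hn'⟩) hqs
    · refine ((Nat.prime_iff_prime_int.1 hp).coprime_iff_not_dvd).2 fun hps ↦ ?_
      have h1 := Nat.le_of_dvd (Int.natAbs_pos.2 hs) (Int.natCast_dvd.1 hps)
      exact absurd (lt_of_le_of_lt (le_max_right _ _) hpgt) (not_lt.2 h1)
  · rw [e]
    have : (p : ℤ) ≤ g * p := le_mul_of_one_le_left (by positivity) hg0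
    have := Int.le_natAbs (a := B)
    linarith

open NumberTheorySymbols in
theorem jacobiSym_eq_one_of_four_mul_dvd {d : ℤ} (hd : 0 < d) {p : ℕ}
    (h : 4 * d ∣ (p : ℤ) + 1) : J(d | p) = 1 := by
  lift d to ℕ using hd.le
  have hd' : 0 < d := by exact_mod_cast hd
  have h' : 4 * d ∣ p + 1 := by exact_mod_cast h
  obtain ⟨k, hk⟩ := h'
  have hodd : Odd p := by
    rw [Nat.odd_iff]
    have : p + 1 = 2 * (2 * d * k) := by rw [hk]; ring
    omega
  have hmod : p % (4 * d) = 4 * d - 1 := by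
    cases k with
    | zero => simp at hk
    | succ k =>
      have : p = (4 * d - 1) + 4 * d * k := by
        have : 4 * d * (k + 1) = 4 * d * k + 4 * d := by ring
        omega
      rw [this, Nat.add_mul_mod_self_left, Nat.mod_eq_of_lt (by omega)]
  rw [jacobiSym.mod_right' d hodd, hmod]
  have hodd' : Odd (4 * d - 1) := by rw [Nat.odd_iff]; omega
  have h1 := jacobiSym.mul_left 4 d (4 * d - 1)
  rw [jacobiSym.at_four hodd', one_mul] at h1
  rw [← h1, jacobiSym.mod_left]
  have : (4 * (d : ℤ)) % ((4 * d - 1 : ℕ) : ℤ) = 1 % ((4 * d - 1 : ℕ) : ℤ) := by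
    apply Int.ModEq.symm
    rw [Int.modEq_iff_dvd]
    exact ⟨1, by push_cast [Nat.cast_sub (show 1 ≤ 4 * d by omega)]; ring⟩
  rw [this, ← jacobiSym.mod_left, jacobiSym.one_left]

open NumberTheorySymbols in
theorem jacobiSym_eq_one_of_dvd_add {N : ℤ} (hN : Odd N) {p q : ℕ} (hp : p % 4 = 3)
    (hq : q % 4 = 1) (hdvd : N ∣ (p : ℤ) + q)
    (h : 0 < N ∧ J(N | q) = 1 ∨ N < 0 ∧ J(N | q) = -1) : J(N | p) = 1 := by
  have hpo : Odd p := by rw [Nat.odd_iff]; omega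
  have hqo : Odd q := by rw [Nat.odd_iff]; omega
  have key : ∀ n : ℕ, Odd n → n ∣ p + q → J(n | p) = J(n | q) := by
    intro n hn hnpq
    have e1 : J(q | n) = J(n | q) := jacobiSym.quadratic_reciprocity_one_mod_four hq hn
    have e2 : J(p | n) = ZMod.χ₄ n * J(q | n) := by
      rw [← jacobiSym.neg _ hn]
      apply jacobiSym.mod_left'
      apply Int.ModEq.symm
      refine Int.modEq_iff_dvd.2 ?_
      have : (n : ℤ) ∣ ((p + q : ℕ) : ℤ) := by exact_mod_cast hnpq
      simpa using this
    rcases (by have := Nat.odd_iff.1 hn; omega : n % 4 = 1 ∨ n % 4 = 3) with h4 | h4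
    · rw [← jacobiSym.quadratic_reciprocity_one_mod_four' hpo h4, e2, e1,
        ZMod.χ₄_nat_one_mod_four h4, one_mul]
    · have := jacobiSym.quadratic_reciprocity_three_mod_four h4 hp
      rw [this, e2, e1, ZMod.χ₄_nat_three_mod_four h4]
      ring
  rcases h with ⟨h0, h1⟩ | ⟨h0, h1⟩
  · lift N to ℕ using h0.le
    rw [key N (by exact_mod_cast hN) (by exact_mod_cast hdvd), h1]
  · obtain ⟨n, rfl⟩ : ∃ n : ℕ, N = -(n : ℤ) := ⟨N.natAbs, by omega⟩
    have hn : Odd n := by simpa using hN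
    rw [jacobiSym.neg _ hqo, ZMod.χ₄_nat_one_mod_four hq, one_mul] at h1
    rw [jacobiSym.neg _ hpo, ZMod.χ₄_nat_three_mod_four hp, key n hn, h1]
    · norm_num
    · have := (neg_dvd.1 hdvd)
      exact_mod_cast this

open NumberTheorySymbols in
theorem dvd_pow_sub_one_of_jacobiSym {N : ℤ} {p e : ℕ} (hp : p.Prime) (hpe : p = 2 * e + 1)
    (h : J(N | p) = 1) : (p : ℤ) ∣ N ^ e - 1 := by
  have := Fact.mk hp
  rw [← jacobiSym.legendreSym.to_jacobiSym] at h
  have h2 := legendreSym.eq_pow p N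
  rw [h, show p / 2 = e by omega] at h2
  rw [← ZMod.intCast_zmod_eq_zero_iff_dvd]
  push_cast
  rw [← h2]
  simp

end Integers

section Quadratic

variable {d : ℤ}

theorem norm_one_add_mul (q : ℤ) (w : ℤ√d) :
    (1 + (q : ℤ√d) * w).norm = 1 + q * (2 * w.re + q * w.norm) := by
  simp only [Zsqrtd.norm_def, Zsqrtd.re_add, Zsqrtd.im_add, Zsqrtd.re_one, Zsqrtd.im_one,
    Zsqrtd.re_mul, Zsqrtd.im_mul, Zsqrtd.re_intCast, Zsqrtd.im_intCast]
  ring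

theorem isCoprime_intCast_iff {a : ℤ} {z : ℤ√d} : IsCoprime (a : ℤ√d) z ↔ IsCoprime a z.norm := by
  constructor
  · rintro ⟨x, y, h⟩
    have h1 : y * z = 1 + (a : ℤ√d) * (-x) := by linear_combination h
    have h2 := congrArg Zsqrtd.norm h1
    rw [norm_one_add_mul, Zsqrtd.norm_mul] at h2
    exact ⟨-(2 * (-x).re + a * (-x).norm), y.norm, by linear_combination h2⟩
  · rintro ⟨x, y, h⟩
    have h1 := congrArg (Int.cast : ℤ → ℤ√d) h
    push_cast [Zsqrtd.norm_eq_mul_conj] at h1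
    exact ⟨x, y * star z, by linear_combination h1⟩

theorem dvd_pow_sub_self {p e : ℕ} (hp : p.Prime) (hpe : p = 2 * e + 1)
    (hd : (p : ℤ) ∣ d ^ e - 1) (z : ℤ√d) : (p : ℤ√d) ∣ z ^ p - z := by
  have := Fact.mk hp
  have hz : z = (z.re : ℤ√d) + (z.im : ℤ√d) * (Zsqrtd.sqrtd : ℤ√d) := by
    ext <;> simp
  obtain ⟨r, hr⟩ := exists_add_pow_prime_eq hp (z.re : ℤ√d) ((z.im : ℤ√d) * (Zsqrtd.sqrtd : ℤ√d))
  have fermat : ∀ n : ℤ, (p : ℤ) ∣ n ^ p - n := fun n ↦ by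
    rw [← ZMod.intCast_zmod_eq_zero_iff_dvd]
    simp
  obtain ⟨x, hx⟩ := fermat z.re
  obtain ⟨y, hy⟩ := fermat z.im
  obtain ⟨t, ht⟩ := hd
  have hx' := congrArg (Int.cast : ℤ → ℤ√d) hx
  have hy' := congrArg (Int.cast : ℤ → ℤ√d) hy
  have ht' := congrArg (Int.cast : ℤ → ℤ√d) ht
  push_cast at hx' hy' ht'
  have hs : (Zsqrtd.sqrtd : ℤ√d) ^ p = (d : ℤ√d) ^ e * (Zsqrtd.sqrtd : ℤ√d) := by
    rw [hpe, pow_succ, pow_mul, sq, Zsqrtd.dmuld]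
  rw [← hz, mul_pow, hs] at hr
  refine ⟨(z.re : ℤ√d) * ((z.im : ℤ√d) * (Zsqrtd.sqrtd : ℤ√d)) * r + x +
    y * (d : ℤ√d) ^ e * (Zsqrtd.sqrtd : ℤ√d) + (z.im : ℤ√d) * t * (Zsqrtd.sqrtd : ℤ√d), ?_⟩
  rw [hr]
  linear_combination hx' + (d : ℤ√d) ^ e * (Zsqrtd.sqrtd : ℤ√d) * hy' +
    (z.im : ℤ√d) * (Zsqrtd.sqrtd : ℤ√d) * ht' - hz

theorem dvd_pow_sub_one {p e : ℕ} (hp : p.Prime) (hpe : p = 2 * e + 1)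
    (hd : (p : ℤ) ∣ d ^ e - 1) {z : ℤ√d} (hz : IsCoprime (p : ℤ√d) z) :
    (p : ℤ√d) ∣ z ^ (2 * e) - 1 := by
  refine hz.dvd_of_dvd_mul_left ?_
  have := dvd_pow_sub_self hp hpe hd z
  have e1 : z * (z ^ (2 * e) - 1) = z ^ p - z := by rw [hpe]; ring
  rwa [e1]

theorem dvd_pow_sub_one_or_dvd_pow_add_one {p e : ℕ} (hp : p.Prime) (hpe : p = 2 * e + 1)
    (he : e ≠ 0) (hd : (p : ℤ) ∣ d ^ e - 1) {c : ℤ√d} (hc : (p : ℤ) ∣ c.norm ^ e - 1) :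
    (p : ℤ√d) ∣ c ^ e - 1 ∨ (p : ℤ√d) ∣ c ^ e + 1 := by
  have hpz : Prime (p : ℤ) := Nat.prime_iff_prime_int.1 hp
  have hcast : ((p : ℤ) : ℤ√d) = (p : ℤ√d) := by push_cast; rfl
  have hcop : IsCoprime (p : ℤ) c.norm := by
    obtain ⟨t, ht⟩ := hc
    refine (IsCoprime.pow_right_iff (Nat.pos_of_ne_zero he)).1 ⟨-t, 1, ?_⟩
    linear_combination ht
  have hcop' : IsCoprime (p : ℤ√d) c := by
    rw [← hcast]
    exact isCoprime_intCast_iff.2 hcop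
  set z := c ^ e with hz
  have hz2 : (p : ℤ√d) ∣ z * z - 1 := by
    have := dvd_pow_sub_one hp hpe hd hcop'
    rwa [two_mul, pow_add] at this
  have hzz : (p : ℤ√d) ∣ z * star z - 1 := by
    have h1 : z * star z - 1 = ((c.norm ^ e - 1 : ℤ) : ℤ√d) := by
      rw [hz, star_pow, ← mul_pow, ← Zsqrtd.norm_eq_mul_conj]
      push_cast
      rfl
    rw [h1, ← hcast]
    exact (Zsqrtd.intCast_dvd_intCast _ _).2 hc
  have hdiff : (p : ℤ√d) ∣ z - star z := by
    refine (hcop'.pow_right (n := e)).dvd_of_dvd_mul_left ?_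
    have := dvd_sub hz2 hzz
    have e1 : z * (z - star z) = z * z - 1 - (z * star z - 1) := by ring
    rwa [hz, e1] at *
  rw [← hcast, Zsqrtd.intCast_dvd] at hz2 hdiff
  have him : (p : ℤ) ∣ z.im := by
    have h2 : (p : ℤ) ∣ 2 * z.im := by
      have := hdiff.2
      simp only [Zsqrtd.im_sub, Zsqrtd.im_star] at this
      rwa [sub_neg_eq_add, ← two_mul] at this
    refine (hpz.dvd_or_dvd h2).resolve_left fun h ↦ ?_
    have := Nat.le_of_dvd two_pos (Int.natCast_dvd.1 h)
    omega
  have hre : (p : ℤ) ∣ (z.re - 1) * (z.re + 1) := by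
    have h1 := hz2.1
    simp only [Zsqrtd.re_sub, Zsqrtd.re_mul, Zsqrtd.re_one] at h1
    have e1 : (z.re - 1) * (z.re + 1) = z.re * z.re + d * z.im * z.im - 1 - d * z.im * z.im := by
      ring
    rw [e1]
    exact dvd_sub h1 (him.mul_left _)
  rw [← hcast, Zsqrtd.intCast_dvd, Zsqrtd.intCast_dvd]
  rcases hpz.dvd_or_dvd hre with h | h
  · left
    simpa using ⟨h, him⟩
  · right
    simpa using ⟨h, him⟩

end Quadratic

section Reduction

theorem isCoprime_of_eq_add {R : Type*} [CommRing R] {x y z : R} (w : R) (h : IsCoprime y z)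
    (e : x = y + z * w) : IsCoprime x z :=
  e ▸ IsCoprime.add_mul_left_left h w

theorem exists_isCoprime_add_mul_add_mul {r s n : ℤ} (hn : Odd n)
    (h : ∀ q : ℤ, Prime q → q ∣ n → q ∣ r → ¬ q ∣ s) :
    ∃ k j, 2 ∣ s + n * j ∧ s + n * j ≠ 0 ∧ IsCoprime (r + n * k) (s + n * j) := by
  have hn0 : n ≠ 0 := by rintro rfl; simp at hn
  have hn2 : IsCoprime n 2 := Int.isCoprime_two_right.2 hn
  obtain ⟨j, hj, hj0⟩ := exists_dvd_add_mul_sub s 0 hn2 hn0 two_ne_zero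
  rw [sub_zero] at hj
  obtain ⟨k, hk, -⟩ := exists_isCoprime_add_mul hn0 hj0 (r := r)
    (fun q hq hqr hqn hqs ↦ h q hq hqn hqr ((dvd_add_left (hqn.mul_right j)).1 hqs)) 0
  exact ⟨k, j, hj, hj0, hk⟩

variable {d : ℤ}

theorem exists_eq_intCast_add_mul {b : ℤ√d} (h : IsCoprime b.im b.norm) (a : ℤ√d) :
    ∃ (k : ℤ) (z : ℤ√d), a = k + b * z := by
  obtain ⟨x, y, hxy⟩ := h
  have h1 := congrArg (Int.cast : ℤ → ℤ√d) hxy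
  push_cast [Zsqrtd.norm_eq_mul_conj] at h1
  have hb : b = (b.re : ℤ√d) + (b.im : ℤ√d) * (Zsqrtd.sqrtd : ℤ√d) := by
    ext <;> simp
  have ha : a = (a.re : ℤ√d) + (a.im : ℤ√d) * (Zsqrtd.sqrtd : ℤ√d) := by
    ext <;> simp
  refine ⟨a.re - a.im * x * b.re, a.im * (x + y * star b * (Zsqrtd.sqrtd : ℤ√d)), ?_⟩
  push_cast
  linear_combination ha - (a.im : ℤ√d) * (Zsqrtd.sqrtd : ℤ√d) * h1 - (a.im : ℤ√d) * x * hb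

theorem intCast_mul_star_norm (b : ℤ√d) : b * star b = (b.norm : ℤ√d) :=
  (Zsqrtd.norm_eq_mul_conj b).symm

/-- The first row can be moved to `(q, M b)` with `q` a large prime. -/
theorem exists_prime_row {M : ℤ} (hM : 2 ∣ M) (hM0 : M ≠ 0)
    {g : SpecialLinearGroup (Fin 2) (ℤ√d)} (hg : g ∈ cong ((M : ℤ√d) ^ 2)) (l : ℕ) :
    ∃ q : ℕ, q.Prime ∧ l < q ∧ M ^ 2 ∣ (q : ℤ) - 1 ∧ ∃ Y ∈ elem (M : ℤ√d), ∃ b : ℤ√d,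
      (g * Y) 0 0 = q ∧ (g * Y) 0 1 = M * b ∧ 2 ∣ b.im ∧ IsCoprime (q : ℤ) b.norm := by
  obtain ⟨⟨a', ha⟩, ⟨b', hb⟩, ⟨c', hc⟩, ⟨d', hd⟩⟩ := mem_cong.1 hg
  have hdet := det_eq g
  rw [hb, hc] at hdet
  set a := g 0 0 with ha0
  have hn : Odd a.norm := by
    have : a = 1 + ((M ^ 2 : ℤ) : ℤ√d) * a' := by push_cast; linear_combination ha
    rw [this, norm_one_add_mul]
    obtain ⟨t, rfl⟩ := hM
    exact ⟨2 * t ^ 2 * (2 * a'.re + (2 * t) ^ 2 * a'.norm), by ring⟩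
  obtain ⟨k, j, h2, hne, hcop⟩ := exists_isCoprime_add_mul_add_mul
    (r := ((M : ℤ√d) * b').re) (s := ((M : ℤ√d) * b').im) hn (by
    intro q hq hqn hqr hqs
    have hqb : (q : ℤ√d) ∣ (M : ℤ√d) * b' := (Zsqrtd.intCast_dvd _ _).2 ⟨hqr, hqs⟩
    obtain ⟨w, hw⟩ := hqb
    have e : a * g 1 1 = 1 + (q : ℤ√d) * (w * M * (M ^ 2 * c')) := by
      linear_combination hdet + (M : ℤ√d) * (M ^ 2 * c') * hw
    have e2 := congrArg Zsqrtd.norm e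
    rw [Zsqrtd.norm_mul, norm_one_add_mul] at e2
    have : q ∣ 1 := by
      have := hqn.mul_right (g 1 1).norm
      rw [e2] at this
      exact (dvd_add_left (dvd_mul_right _ _)).1 this
    exact hq.not_isUnit (isUnit_of_dvd_one this))
  set b1 : ℤ√d := M * b' + a * (star a * ⟨k, j⟩) with hb1
  have hre : b1.re = ((M : ℤ√d) * b').re + a.norm * k := by
    rw [hb1, ← mul_assoc, intCast_mul_star_norm]
    simp
  have him : b1.im = ((M : ℤ√d) * b').im + a.norm * j := by
    rw [hb1, ← mul_assoc, intCast_mul_star_norm]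
    simp
  rw [← hre, ← him] at hcop
  rw [← him] at h2 hne
  have hN : IsCoprime b1.im b1.norm := by
    have h3 : IsCoprime b1.im (b1.re * b1.re + b1.im * (-d * b1.im)) :=
      IsCoprime.add_mul_left_right (hcop.symm.mul_right hcop.symm) _
    convert h3 using 1
    rw [Zsqrtd.norm_def]
    ring
  have hN0 : b1.norm ≠ 0 := by
    intro h0
    rw [h0, isCoprime_zero_right] at hN
    have := isUnit_of_dvd_unit h2 hN
    exact absurd this (by decide)
  obtain ⟨k', z, hz⟩ := exists_eq_intCast_add_mul hN a'
  have hY1 : up ((M : ℤ√d) * (star a * ⟨k, j⟩)) * lo ((M : ℤ√d) * -z) ∈ elem (M : ℤ√d) :=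
    mul_mem (up_mem_elem (dvd_mul_right _ _)) (lo_mem_elem (dvd_mul_right _ _))
  set Y1 := up ((M : ℤ√d) * (star a * ⟨k, j⟩)) * lo ((M : ℤ√d) * -z) with hY1def
  have r01 : (g * Y1) 0 1 = M * b1 := by
    rw [hY1def, ← mul_assoc]
    simp only [mul01, up01, up11, lo01, lo11, ← ha0, hb, mul00, up00, up10, hb1]
    ring
  have r00 : (g * Y1) 0 0 = ((1 + M ^ 2 * k' : ℤ) : ℤ√d) := by
    rw [hY1def, ← mul_assoc]
    simp only [mul01, up01, up11, lo00, lo10, ← ha0, hb, mul00, up00, up10]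
    push_cast
    rw [hb1] at hz
    linear_combination ha + (M : ℤ√d) ^ 2 * hz
  have hcop1 : IsCoprime (1 + M ^ 2 * k') b1.norm := by
    rw [← isCoprime_intCast_iff]
    have := det_eq (g * Y1)
    rw [r00, r01] at this
    exact ⟨(g * Y1) 1 1, -(M * (g * Y1) 1 0), by linear_combination this⟩
  have hcop2 : IsCoprime (1 + M ^ 2 * k') (M ^ 2 * b1.norm) :=
    IsCoprime.mul_right ⟨1, -k', by ring⟩ hcop1
  obtain ⟨q, hql, hq, hqm⟩ := Nat.forall_exists_prime_gt_and_zmodEq l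
    (q := (M ^ 2 * b1.norm).natAbs) (a := 1 + M ^ 2 * k')
    (Int.natAbs_ne_zero.2 (mul_ne_zero (pow_ne_zero 2 hM0) hN0))
    (by rwa [Int.natCast_natAbs, IsCoprime.abs_right_iff])
  obtain ⟨t, ht⟩ : M ^ 2 * b1.norm ∣ (q : ℤ) - (1 + M ^ 2 * k') :=
    Int.natAbs_dvd.1 (Int.modEq_iff_dvd.1 hqm.symm)
  have ht' := congrArg (Int.cast : ℤ → ℤ√d) ht
  push_cast [Zsqrtd.norm_eq_mul_conj] at ht'
  refine ⟨q, hq, hql, ⟨b1.norm * t + k', by linear_combination ht⟩,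
    Y1 * lo ((M : ℤ√d) * (star b1 * t)), mul_mem hY1 (lo_mem_elem (dvd_mul_right _ _)), b1,
    ?_, ?_, h2, ?_⟩
  · rw [← mul_assoc, mul00, r00, r01]
    simp only [lo00, lo10]
    push_cast
    linear_combination -ht'
  · rw [← mul_assoc, mul01, r00, r01]
    simp
  · have : (q : ℤ) = 1 + M ^ 2 * k' + b1.norm * (M ^ 2 * t) := by linear_combination ht
    rw [this]
    exact IsCoprime.add_mul_left_left hcop1 _

open NumberTheorySymbols in
theorem exists_norm_sign (hd : 0 < d) {r s l : ℤ} {q : ℕ} (hq : q.Prime) (hs : 2 ∣ s)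
    (hq2 : Odd (q : ℤ)) (hl : Odd l) (hld : IsCoprime l d) (hlq : IsCoprime (q : ℤ) l)
    (hcop : IsCoprime (q : ℤ) (r * r - d * s * s)) :
    ∃ k j N : ℤ, N = (r + q * k) * (r + q * k) - d * (s + q * j) * (s + q * j) ∧
      Odd N ∧ IsCoprime N l ∧ IsCoprime N q ∧
      (0 < N ∧ J(N | q) = 1 ∨ N < 0 ∧ J(N | q) = -1) := by
  have hq0 : (q : ℤ) ≠ 0 := by exact_mod_cast hq.ne_zero
  have hl0 : l ≠ 0 := by rintro rfl; simp at hl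
  have h2 : ∀ n : ℤ, Odd n → IsCoprime n 2 := fun n hn ↦
    Int.isCoprime_two_right.2 hn
  have hq2l : IsCoprime (q : ℤ) (2 * l) := (h2 _ hq2).mul_right hlq
  have hN : ∀ k j : ℤ, (r + q * k) * (r + q * k) - d * (s + q * j) * (s + q * j) =
      r * r - d * s * s + q * (2 * r * k + q * k * k - d * (2 * s * j + q * j * j)) := by
    intro k j; ring
  have hNq : ∀ k j : ℤ,
      IsCoprime ((r + q * k) * (r + q * k) - d * (s + q * j) * (s + q * j)) q := by
    intro k j
    rw [hN]
    exact IsCoprime.add_mul_left_left hcop.symm _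
  have hJ : ∀ k j : ℤ, J((r + q * k) * (r + q * k) - d * (s + q * j) * (s + q * j) | q) =
      J(r * r - d * s * s | q) := by
    intro k j
    apply jacobiSym.mod_left'
    rw [hN]
    simp
  have hrs : ∀ π : ℤ, Prime π → π ∣ q → π ∣ r → ¬ π ∣ s := by
    intro π hπ h1 h3 h4
    exact hπ.not_isUnit (hcop.isUnit_of_dvd' h1 (dvd_sub (h3.mul_right r) (h4.mul_left _)))
  rcases jacobiSym.eq_one_or_neg_one (Int.isCoprime_iff_gcd_eq_one.1 hcop.symm) with h | h
  · obtain ⟨j, hj, hj0⟩ := exists_dvd_add_mul_sub s 0 hq2l hq0 (mul_ne_zero two_ne_zero hl0)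
    rw [sub_zero] at hj
    obtain ⟨k, hk, hkB⟩ := exists_isCoprime_add_mul hq0 hj0 (r := r)
      (fun π hπ h1 h3 h4 ↦ hrs π hπ h3 h1 ((dvd_add_left (h3.mul_right j)).1 h4))
      (d * (s + q * j) ^ 2 + 1)
    refine ⟨k, j, _, rfl, ?_, ?_, hNq k j, Or.inl ⟨?_, (hJ k j).trans h⟩⟩
    · have hr : Odd (r + q * k) :=
        Int.isCoprime_two_right.1 (hk.of_isCoprime_of_dvd_right ((dvd_mul_right 2 l).trans hj))
      refine (hr.mul hr).sub_even ?_
      exact (even_iff_two_dvd.2 ((dvd_mul_right 2 l).trans hj)).mul_left _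
    · have hr := hk.of_isCoprime_of_dvd_right ((dvd_mul_left l 2).trans hj)
      obtain ⟨t, ht⟩ := (dvd_mul_left l 2).trans hj
      exact isCoprime_of_eq_add (-(d * t * (s + q * j))) (hr.mul_left hr)
        (by linear_combination (-d * (s + q * j)) * ht)
    · have : 0 ≤ d * (s + q * j) ^ 2 := by positivity
      nlinarith
  · obtain ⟨k, hk, hk0⟩ := exists_dvd_add_mul_sub r l hq2l hq0 (mul_ne_zero two_ne_zero hl0)
    have hodd : Odd (r + q * k) := by
      obtain ⟨t, ht⟩ := hk
      have : r + q * k = l + 2 * (l * t) := by linear_combination ht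
      rw [this]
      exact hl.add_even (even_two_mul _)
    have hlr : l ∣ r + q * k := by
      have := ((dvd_mul_left l 2).trans hk).add (dvd_refl l)
      rwa [sub_add_cancel] at this
    obtain ⟨j, hj, hjB⟩ := exists_isCoprime_add_mul (mul_ne_zero two_ne_zero hq0) hk0 (r := s)
      (fun π hπ h1 h3 h4 ↦ by
        rcases hπ.dvd_or_dvd h3 with h3 | h3
        · exact hπ.not_isUnit ((h2 _ hodd).isUnit_of_dvd' h4 h3)
        · exact hrs π hπ h3 ((dvd_add_left (h3.mul_right k)).1 h4) h1)
      ((r + q * k) ^ 2)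
    have ej : s + 2 * q * j = s + q * (2 * j) := by ring
    rw [ej] at hj hjB
    refine ⟨k, 2 * j, _, rfl, ?_, ?_, hNq k _, Or.inr ⟨?_, (hJ k _).trans h⟩⟩
    · refine (hodd.mul hodd).sub_even ?_
      refine Even.mul_left (even_iff_two_dvd.2 (dvd_add hs ?_)) _
      exact ⟨q * j, by ring⟩
    · have hr := hj.of_isCoprime_of_dvd_right hlr
      obtain ⟨t, ht⟩ := hlr
      exact isCoprime_of_eq_add (t * (r + q * k)) ((hld.symm.neg_left.mul_left hr).mul_left hr)
        (by linear_combination (r + q * k) * ht)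
    · have h0 : 0 < (r + q * k) ^ 2 := by positivity
      have h1 : (r + q * k) ^ 2 < (s + q * (2 * j)) ^ 2 := by nlinarith
      nlinarith

/-- Every element of a deep congruence subgroup can be moved by elementary matrices so that its
first row is `(-p, M b)` for a suitable prime `p = 2 e + 1`, with `e` prime to `l`. -/
theorem exists_reduction (hd : 0 < d) {M : ℤ} (hM : 8 * d ∣ M) (hM0 : M ≠ 0)
    {g : SpecialLinearGroup (Fin 2) (ℤ√d)} (hg : g ∈ cong ((M : ℤ√d) ^ 2)) {l : ℕ}
    (hl : l.Prime) :
    ∃ p e : ℕ, p.Prime ∧ p = 2 * e + 1 ∧ Odd e ∧ ¬ l ∣ e ∧ 4 * d ∣ (p : ℤ) + 1 ∧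
      M ^ 2 ∣ (p : ℤ) + 1 ∧ ∃ Y ∈ elem (M : ℤ√d), ∃ b : ℤ√d, (g * Y) 0 0 = -(p : ℤ√d) ∧
        (g * Y) 0 1 = M * b ∧ (p : ℤ) ∣ b.norm ^ e - 1 := by
  have hM2 : 2 ∣ M := Dvd.dvd.trans ⟨4 * d, by ring⟩ hM
  have hM4 : 4 * d ∣ M ^ 2 := by
    rw [sq]
    exact Dvd.dvd.mul_right (Dvd.dvd.trans ⟨2, by ring⟩ hM) M
  obtain ⟨q, hq, hlq, hqM, Y, hY, b1, h00, h01, him, hcop⟩ := exists_prime_row hM2 hM0 hg l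
  have hq4 : q % 4 = 1 := by
    have : (4 : ℤ) ∣ q - 1 := ((dvd_mul_right 4 d).trans hM4).trans hqM
    omega
  have hqodd : Odd (q : ℤ) := by
    rw [Int.odd_iff]
    omega
  have hqM' : IsCoprime (q : ℤ) M := by
    obtain ⟨t, ht⟩ := hqM
    exact ⟨1, -(M * t), by linear_combination ht⟩
  obtain ⟨l', hl'odd, hl'M, hl'q, hl'l⟩ : ∃ l' : ℤ, Odd l' ∧ IsCoprime l' M ∧
      IsCoprime (q : ℤ) l' ∧ ((l : ℤ) ∣ M ∨ (l : ℤ) ∣ l') := by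
    by_cases h : (l : ℤ) ∣ M
    · exact ⟨1, odd_one, isCoprime_one_left, isCoprime_one_right, Or.inl h⟩
    · have hc : IsCoprime (l : ℤ) M := (Nat.prime_iff_prime_int.1 hl).coprime_iff_not_dvd.2 h
      refine ⟨l, ?_, hc, ?_, Or.inr dvd_rfl⟩
      · exact Int.isCoprime_two_right.1 (hc.of_isCoprime_of_dvd_right hM2)
      · exact Nat.isCoprime_iff_coprime.2 ((Nat.coprime_primes hq hl).2 (by omega))
  rw [Zsqrtd.norm_def] at hcop
  obtain ⟨k, j, N, hNdef, hNodd, hNl, hNq, hsign⟩ := exists_norm_sign hd hq him hqodd hl'odd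
    (hl'M.of_isCoprime_of_dvd_right (Dvd.dvd.trans ⟨8, by ring⟩ hM)) hl'q hcop
  have hN0 : N ≠ 0 := by rintro rfl; simp at hNodd
  have hl'0 : l' ≠ 0 := by rintro rfl; simp at hl'odd
  obtain ⟨x, y, hxy⟩ : IsCoprime l' (M ^ 2 * N) := (hl'M.pow_right).mul_right hNl.symm
  have hx1 : IsCoprime (-(q * (x * l')) - y * (M ^ 2 * N)) (M ^ 2 * N * l') := by
    refine IsCoprime.mul_right ?_ ?_
    · have h1 : IsCoprime (q : ℤ) (M ^ 2 * N) := (hqM'.pow_right).mul_right hNq.symm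
      exact isCoprime_of_eq_add ((q - 1) * y) h1.neg_left (by linear_combination -(q : ℤ) * hxy)
    · exact isCoprime_of_eq_add ((1 - q) * x) isCoprime_one_left.neg_left
        (by linear_combination (-1 : ℤ) * hxy)
  obtain ⟨p, -, hp, hpm⟩ := Nat.forall_exists_prime_gt_and_zmodEq 0
    (q := (M ^ 2 * N * l').natAbs) (a := -(q * (x * l')) - y * (M ^ 2 * N))
    (Int.natAbs_ne_zero.2 (mul_ne_zero (mul_ne_zero (pow_ne_zero 2 hM0) hN0) hl'0))
    (by rwa [Int.natCast_natAbs, IsCoprime.abs_right_iff])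
  obtain ⟨t, ht⟩ : M ^ 2 * N * l' ∣ (p : ℤ) - (-(q * (x * l')) - y * (M ^ 2 * N)) :=
    Int.natAbs_dvd.1 (Int.modEq_iff_dvd.1 hpm.symm)
  have hpq : (p : ℤ) + q = M ^ 2 * N * (l' * t + (q - 1) * y) := by
    linear_combination ht - (q : ℤ) * hxy
  have hpl : l' ∣ (p : ℤ) + 1 :=
    ⟨M ^ 2 * N * t + (1 - q) * x, by linear_combination ht - hxy⟩
  have hpM : M ^ 2 ∣ (p : ℤ) + 1 := by
    have h1 : M ^ 2 ∣ (p : ℤ) + q := ⟨_, hpq.trans (mul_assoc _ _ _)⟩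
    have := dvd_sub h1 hqM
    rwa [show (p : ℤ) + q - (q - 1) = p + 1 by ring] at this
  have hp4d : 4 * d ∣ (p : ℤ) + 1 := hM4.trans hpM
  have hp4 : p % 4 = 3 := by
    have : (4 : ℤ) ∣ p + 1 := (dvd_mul_right 4 d).trans hp4d
    omega
  have hlp : (l : ℤ) ∣ p + 1 := by
    rcases hl'l with h | h
    · exact (h.trans (Dvd.intro_left _ (sq M).symm)).trans hpM
    · exact h.trans hpl
  have hpe : p = 2 * (p / 2) + 1 := by omega
  have heodd : Odd (p / 2) := by
    rw [Nat.odd_iff]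
    omega
  have hbN : (b1 + (q : ℤ√d) * ⟨k, j⟩).norm = N := by
    rw [hNdef, Zsqrtd.norm_def]
    simp
  refine ⟨p, p / 2, hp, hpe, heodd, ?_, hp4d, hpM,
    Y * up ((M : ℤ√d) * ⟨k, j⟩) * lo ((M : ℤ√d) * (star (b1 + (q : ℤ√d) * ⟨k, j⟩) *
      ((-(l' * t + (q - 1) * y) : ℤ) : ℤ√d))),
    mul_mem (mul_mem hY (up_mem_elem (dvd_mul_right _ _))) (lo_mem_elem (dvd_mul_right _ _)),
    b1 + (q : ℤ√d) * ⟨k, j⟩, ?_, ?_, ?_⟩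
  · intro hle
    have h1 : l ∣ 2 * (p / 2 + 1) := by
      have : l ∣ p + 1 := by exact_mod_cast hlp
      rwa [show p + 1 = 2 * (p / 2 + 1) by omega] at this
    rcases hl.dvd_mul.1 h1 with h2 | h2
    · rw [(Nat.prime_dvd_prime_iff_eq hl Nat.prime_two).1 h2] at hle
      exact (Nat.not_even_iff_odd.2 heodd) (even_iff_two_dvd.2 hle)
    · exact hl.one_lt.ne' (Nat.dvd_one.1 ((Nat.dvd_add_right hle).1 h2))
  · rw [← mul_assoc, ← mul_assoc, mul00 (g * Y * _), mul00 (g * Y), mul01 (g * Y), h00, h01]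
    simp only [up00, up10, up01, up11, lo00, lo10]
    have e1 := congrArg (Int.cast : ℤ → ℤ√d) hpq
    push_cast at e1
    have e2 := intCast_mul_star_norm (b1 + (q : ℤ√d) * ⟨k, j⟩)
    rw [hbN] at e2
    push_cast
    linear_combination e1 - (M : ℤ√d) ^ 2 * (l' * t + (q - 1) * y) * e2
  · rw [← mul_assoc, ← mul_assoc, mul01 (g * Y * _), mul01 (g * Y), h00, h01]
    simp only [up01, up11, lo01, lo11]
    ring
  · rw [hbN]
    refine dvd_pow_sub_one_of_jacobiSym hp hpe (jacobiSym_eq_one_of_dvd_add hNodd hp4 hq4 ?_ hsign)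
    exact ⟨M ^ 2 * (l' * t + (q - 1) * y), by rw [hpq]; ring⟩

end Reduction

section Twist

variable {G : Type*} [Group G]

/-- The elements `x` normalizing `E` such that `x g x⁻¹ ∈ E g E`. -/
def twist (E : Subgroup G) (g : G) : Subgroup G where
  carrier := {x | (∀ y, y ∈ E ↔ x * y * x⁻¹ ∈ E) ∧ ∃ X ∈ E, ∃ Y ∈ E, x * g * x⁻¹ = X * g * Y}
  one_mem' := ⟨by simp, 1, one_mem E, 1, one_mem E, by simp⟩
  mul_mem' := by
    rintro x y ⟨hx, X, hX, Y, hY, e⟩ ⟨hy, X', hX', Y', hY', e'⟩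
    refine ⟨fun z ↦ ?_, x * X' * x⁻¹ * X, mul_mem ((hx _).1 hX') hX,
      Y * (x * Y' * x⁻¹), mul_mem hY ((hx _).1 hY'), ?_⟩
    · rw [hy z, hx]
      simp only [mul_assoc, _root_.mul_inv_rev]
    · calc x * y * g * (x * y)⁻¹ = x * (y * g * y⁻¹) * x⁻¹ := by group
        _ = x * X' * x⁻¹ * (x * g * x⁻¹) * (x * Y' * x⁻¹) := by rw [e']; group
        _ = _ := by rw [e]; group
  inv_mem' := by
    rintro x ⟨hx, X, hX, Y, hY, e⟩
    have hx' : ∀ y, y ∈ E ↔ x⁻¹ * y * x⁻¹⁻¹ ∈ E := by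
      intro y
      rw [hx (x⁻¹ * y * x⁻¹⁻¹)]
      simp [mul_assoc]
    refine ⟨hx', x⁻¹ * X⁻¹ * x⁻¹⁻¹, (hx' _).1 (inv_mem hX), x⁻¹ * Y⁻¹ * x⁻¹⁻¹,
      (hx' _).1 (inv_mem hY), ?_⟩
    have e2 : g = X⁻¹ * (x * g * x⁻¹) * Y⁻¹ := by rw [e]; group
    calc x⁻¹ * g * x⁻¹⁻¹ = x⁻¹ * (X⁻¹ * (x * g * x⁻¹) * Y⁻¹) * x⁻¹⁻¹ := by rw [← e2]
      _ = _ := by group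

theorem mem_twist_of_mul {E : Subgroup G} {g x Z : G} (hZ : Z ∈ E) (h : x ∈ twist E (g * Z)) :
    x ∈ twist E g := by
  obtain ⟨hx, X, hX, Y, hY, e⟩ := h
  refine ⟨hx, X, hX, Z * Y * (x * Z * x⁻¹)⁻¹,
    mul_mem (mul_mem hZ hY) (inv_mem ((hx _).1 hZ)), ?_⟩
  calc x * g * x⁻¹ = x * (g * Z) * x⁻¹ * (x * Z * x⁻¹)⁻¹ := by group
    _ = _ := by rw [e]; group

theorem mem_of_forall_prime {H : Subgroup G} {x : G}
    (h : ∀ l : ℕ, l.Prime → ∃ e : ℕ, ¬ l ∣ e ∧ x ^ e ∈ H) : x ∈ H := by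
  obtain ⟨n, hn⟩ := Int.subgroup_cyclic (H.comap (zpowersHom G x)).toAddSubgroup'
  have key : ∀ k : ℤ, x ^ k ∈ H ↔ n ∣ k := by
    intro k
    rw [← Int.mem_zmultiples_iff, ← AddSubgroup.zmultiples_eq_closure] at *
    rw [← hn]
    rfl
  by_cases h1 : n.natAbs = 1
  · have := (key 1).2 (Int.natAbs_dvd_natAbs.1 (by simp [h1]))
    simpa using this
  · obtain ⟨l, hl, hln⟩ := Nat.exists_prime_and_dvd h1
    obtain ⟨e, he, hx⟩ := h l hl
    rw [← zpow_natCast, key] at hx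
    exact absurd (hln.trans (by simpa using Int.natAbs_dvd_natAbs.2 hx)) he

end Twist

section DiagonalConjugation

variable {d : ℤ}

theorem dia_normalizes {S : Type*} [CommRing S] (m : S) (u : Sˣ)
    (y : SpecialLinearGroup (Fin 2) S) : y ∈ elem m ↔ dia u * y * (dia u)⁻¹ ∈ elem m := by
  refine ⟨dia_conj_elem u, fun h ↦ ?_⟩
  have hinv : dia u⁻¹ = (dia u)⁻¹ := map_inv diaHom u
  have := dia_conj_elem u⁻¹ h
  rw [hinv] at this
  simpa [mul_assoc] using this

theorem dvd_pow_sub_one_of_four_mul_dvd (hd : 0 < d) {p e : ℕ} (hp : p.Prime)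
    (hpe : p = 2 * e + 1) (h : 4 * d ∣ (p : ℤ) + 1) : (p : ℤ) ∣ d ^ e - 1 :=
  dvd_pow_sub_one_of_jacobiSym hp hpe (jacobiSym_eq_one_of_four_mul_dvd hd h)

/-- Conjugating by a diagonal unit matrix only changes `g` by elementary matrices. -/
theorem exists_dia_conj_eq (hd : 0 < d) {M : ℤ} (hM : 8 * d ∣ M) (hM0 : M ≠ 0)
    {g : SpecialLinearGroup (Fin 2) (ℤ√d)} (hg : g ∈ cong ((M : ℤ√d) ^ 2)) (u : (ℤ√d)ˣ) :
    ∃ X ∈ elem (M : ℤ√d), ∃ Y ∈ elem (M : ℤ√d), dia u * g * (dia u)⁻¹ = X * g * Y := by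
  suffices h : dia u ∈ twist (elem (M : ℤ√d)) g from h.2
  refine mem_of_forall_prime fun l hl ↦ ?_
  obtain ⟨p, e, hp, hpe, -, hle, hp4d, -, Y, hY, b, h00, h01, -⟩ := exists_reduction hd hM hM0 hg hl
  refine ⟨e, hle, mem_twist_of_mul hY ?_⟩
  have hgM : g * Y ∈ cong (M : ℤ√d) :=
    mul_mem (cong_anti (Dvd.intro_left _ (sq _).symm) hg) (elem_le_cong _ hY)
  obtain ⟨w, hw⟩ := dvd_pow_sub_one hp hpe (dvd_pow_sub_one_of_four_mul_dvd hd hp hpe hp4d)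
    (z := (u : ℤ√d)) (isCoprime_one_right.of_isCoprime_of_dvd_right u.isUnit.dvd)
  have hD : dia u ^ e = dia (u ^ e) := (map_pow diaHom u e).symm
  rw [hD]
  have hup : up ((M : ℤ√d) * -(w * b)) ∈ elem (M : ℤ√d) := up_mem_elem (dvd_mul_right _ _)
  obtain ⟨X, hX, hX'⟩ := exists_eq_lo_mul (g := g * Y * up ((M : ℤ√d) * -(w * b)))
    (h := dia (u ^ e) * (g * Y) * (dia (u ^ e))⁻¹) (mul_mem hgM (elem_le_cong _ hup))
    (Subgroup.Normal.conj_mem inferInstance _ hgM _)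
    (by
      rw [mul00, mul00 (_ * (g * Y)), mul00 (dia _), mul01 (dia _)]
      rw [h00]
      simp [mul_right_comm, ← mul_pow])
    (by
      rw [mul01, mul01 (_ * (g * Y)), mul00 (dia _), mul01 (dia _)]
      rw [h00, h01]
      simp
      linear_combination (-(M : ℤ√d) * b) * hw)
  exact ⟨dia_normalizes _ _, X, hX, _, hup, by rw [hX']; group⟩

end DiagonalConjugation

section BaseChange

variable {S F : Type*} [CommRing S] [CommRing F] (ι : S →+* F)

theorem map_entry (g : SpecialLinearGroup (Fin 2) S) (i j : Fin 2) :
    SpecialLinearGroup.map ι g i j = ι (g i j) := rfl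

theorem map_up (x : S) : SpecialLinearGroup.map ι (up x) = up (ι x) := by
  apply ext4 <;> simp [map_entry]

theorem map_lo (x : S) : SpecialLinearGroup.map ι (lo x) = lo (ι x) := by
  apply ext4 <;> simp [map_entry]

theorem map_wy : SpecialLinearGroup.map ι wy = wy := by
  apply ext4 <;> simp [map_entry]

variable {ι}

theorem map_injective (hι : Function.Injective ι) :
    Function.Injective (SpecialLinearGroup.map (n := Fin 2) ι) := by
  intro g h e
  have : ∀ i j, ι (g i j) = ι (h i j) := fun i j ↦ by rw [← map_entry, e, map_entry]
  exact ext4 (hι (this _ _)) (hι (this _ _)) (hι (this _ _)) (hι (this _ _))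

theorem exists_map_eq_up_conj {s N : S} {t : F} (hst : ι s * t = 1)
    {k : SpecialLinearGroup (Fin 2) S} (hk : k ∈ cong (N * s ^ 2)) :
    ∃ g ∈ cong N, SpecialLinearGroup.map ι g =
      up t * SpecialLinearGroup.map ι k * (up t)⁻¹ := by
  obtain ⟨⟨a', ha⟩, ⟨b', hb⟩, ⟨c', hc⟩, ⟨d', hd⟩⟩ := mem_cong.1 hk
  have hdet := det_eq k
  refine ⟨mk4 (k 0 0 + N * s * c') (k 0 1 - N * s * a' + N * s * d' - N * c') (k 1 0)
    (k 1 1 - N * s * c') ?_, mem_cong.2 ⟨⟨s ^ 2 * a' + s * c', ?_⟩,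
      ⟨s ^ 2 * b' - s * a' + s * d' - c', ?_⟩, ⟨s ^ 2 * c', ?_⟩, ⟨s ^ 2 * d' - s * c', ?_⟩⟩, ?_⟩
  · rw [hc, hb] at *
    linear_combination hdet + N * s * c' * (hd - ha)
  · simp only [mk4_00]
    linear_combination ha
  · simp only [mk4_01]
    linear_combination hb
  · simp only [mk4_10]
    linear_combination hc
  · simp only [mk4_11]
    linear_combination hd
  · have ha' := congrArg ι ha
    have hc' := congrArg ι hc
    have hd' := congrArg ι hd
    simp only [map_mul, map_pow, map_sub, map_one] at ha' hc' hd'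
    rw [up_inv]
    apply ext4
    · simp [map_entry]
      linear_combination (-t) * hc' - ι N * ι s * ι c' * hst
    · simp [map_entry]
      linear_combination t * ha' - t * hd' + t ^ 2 * hc' + (ι N * ι s * (ι a' - ι d') +
        ι N * ι c' * (ι s * t + 1)) * hst
    · simp [map_entry]
    · simp [map_entry]
      linear_combination t * hc' + ι N * ι s * ι c' * hst

end BaseChange

section ConjugationInvariance

variable {d : ℤ} {F : Type*} [Field F] {ι : ℤ√d →+* F} {A : Type*} [CommGroup A]

theorem dvd_norm (x : ℤ√d) : x ∣ (x.norm : ℤ√d) :=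
  ⟨star x, Zsqrtd.norm_eq_mul_conj x⟩

theorem exists_map_eq_up_conj_of_mem_elem (φ : SpecialLinearGroup (Fin 2) (ℤ√d) →* A)
    {m s : ℤ√d} (hφ : elem m ≤ φ.ker) {M : ℤ√d} (hM : m * s ^ 2 ∣ M) {t : F} (hst : ι s * t = 1)
    {X : SpecialLinearGroup (Fin 2) (ℤ√d)} (hX : X ∈ elem M) :
    ∃ X', φ X' = 1 ∧ SpecialLinearGroup.map ι X' =
      up t * SpecialLinearGroup.map ι X * (up t)⁻¹ := by
  suffices h : elem M ≤ (φ.ker.map (SpecialLinearGroup.map ι)).comap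
      ((MulAut.conj (up t)).toMonoidHom.comp (SpecialLinearGroup.map ι)) by
    obtain ⟨X', h1, h2⟩ := h hX
    exact ⟨X', h1, h2⟩
  obtain ⟨r, rfl⟩ := hM
  refine elem_le (fun x ↦ ?_) (fun x ↦ ?_)
  · refine ⟨up (m * s ^ 2 * r * x), hφ (up_mem_elem ⟨s ^ 2 * r * x, by ring⟩), ?_⟩
    change _ = up t * SpecialLinearGroup.map ι _ * (up t)⁻¹
    rw [map_up, up_inv, ← up_add, ← up_add]
    congr 1
    ring
  · refine ⟨lo s * up (-(m * (r * x))) * (lo s)⁻¹, ?_, ?_⟩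
    · have : φ (up (-(m * (r * x)))) = 1 := hφ (up_mem_elem ⟨-(r * x), by ring⟩)
      change φ _ = 1
      rw [map_mul, map_mul, map_inv, this, mul_one, mul_inv_cancel]
    · change _ = up t * SpecialLinearGroup.map ι _ * (up t)⁻¹
      rw [lo_inv, up_inv, map_mul, map_mul, map_lo, map_lo, map_lo, map_up]
      apply ext4
      · simp
        linear_combination (-ι m * ι s * ι r * ι x) * hst
      · simp
        linear_combination (ι m * ι r * ι x * (ι s * t + 1)) * hst
      · simp
        ring
      · simp
        linear_combination (-ι m * ι s * ι r * ι x) * hst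

variable (hι : Function.Injective ι) (hd : 0 < d) {m : ℤ} (hm : 8 * d ∣ m) (hm0 : m ≠ 0)
  (φ : SpecialLinearGroup (Fin 2) (ℤ√d) →* A) (u : (ℤ√d)ˣ) (hu : (u : ℤ√d) * u - 1 ∣ m)
include hι hd hm hm0 hu

theorem map_eq_of_up_conj {x : ℤ√d} (hx : x.norm ≠ 0) {h k : SpecialLinearGroup (Fin 2) (ℤ√d)}
    (hk : k ∈ cong ((m * x.norm : ℤ√d) ^ 8))
    (e : SpecialLinearGroup.map ι h =
      up (ι x)⁻¹ * SpecialLinearGroup.map ι k * (up (ι x)⁻¹)⁻¹) : φ h = φ k := by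
  have hφ : elem (m : ℤ√d) ≤ φ.ker := elem_le_ker φ u hu
  set v : ℤ√d := (u⁻¹ : (ℤ√d)ˣ) * (u⁻¹ : (ℤ√d)ˣ) - 1 with hv
  have huu : (u : ℤ√d) * (u⁻¹ : (ℤ√d)ˣ) = 1 := u.mul_inv
  have hvm : v ∣ m := by
    refine Dvd.dvd.trans ⟨-(u * u), ?_⟩ hu
    linear_combination (u * (u⁻¹ : (ℤ√d)ˣ) + 1 : ℤ√d) * huu
  have hs : x * v ∣ m * x.norm := by
    rw [mul_comm x v]
    exact mul_dvd_mul hvm (dvd_norm x)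
  have hmS : (m : ℤ√d) ≠ 0 := by exact_mod_cast hm0
  have hx0 : x ≠ 0 := by rintro rfl; simp at hx
  have hv0 : v ≠ 0 := fun h0 ↦ hmS (zero_dvd_iff.1 (h0 ▸ hvm))
  have hιx : ι x ≠ 0 := (map_ne_zero_iff ι hι).2 hx0
  have hιv : ι v ≠ 0 := (map_ne_zero_iff ι hι).2 hv0
  set t : F := (ι x * ι v)⁻¹ with ht
  have hst : ι (x * v) * t = 1 := by
    rw [map_mul]
    exact mul_inv_cancel₀ (mul_ne_zero hιx hιv)
  set M : ℤ := m * (m * x.norm) ^ 2 with hM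
  have hM8 : 8 * d ∣ M := hm.mul_right _
  have hM0 : M ≠ 0 := mul_ne_zero hm0 (pow_ne_zero 2 (mul_ne_zero hm0 hx))
  have hMs : (m : ℤ√d) * (x * v) ^ 2 ∣ M := by
    rw [hM]
    push_cast
    exact mul_dvd_mul_left _ (pow_dvd_pow_of_dvd hs 2)
  have hk' : k ∈ cong ((M : ℤ√d) ^ 2 * (-(x * v)) ^ 2) := by
    refine cong_anti ?_ hk
    rw [neg_sq, hM]
    push_cast
    refine Dvd.dvd.trans (mul_dvd_mul_left _ (pow_dvd_pow_of_dvd hs 2)) ⟨(x.norm : ℤ√d) ^ 2, ?_⟩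
    ring
  obtain ⟨g, hg, hgk⟩ := exists_map_eq_up_conj (t := -t) (ι := ι)
    (by rw [map_neg, neg_mul_neg, hst]) hk'
  obtain ⟨X, hX, Y, hY, hXY⟩ := exists_dia_conj_eq hd hM8 hM0 hg u
  obtain ⟨X', hX1, hX2⟩ := exists_map_eq_up_conj_of_mem_elem φ hφ hMs hst hX
  obtain ⟨Y', hY1, hY2⟩ := exists_map_eq_up_conj_of_mem_elem φ hφ hMs hst hY
  have hk2 : SpecialLinearGroup.map ι k = up t * SpecialLinearGroup.map ι g * (up t)⁻¹ := by
    rw [hgk, ← up_inv]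
    group
  have hcomm : up t * SpecialLinearGroup.map ι (dia u) =
      SpecialLinearGroup.map ι (dia u) * up (ι x)⁻¹ * up t := by
    rw [mul_assoc, ← up_add]
    apply ext4
    · simp [map_entry]
    · simp [map_entry]
      have e1 : ι u * ι (u⁻¹ : (ℤ√d)ˣ) = 1 := by rw [← map_mul, huu, map_one]
      have e2 : ι v = ι (u⁻¹ : (ℤ√d)ˣ) * ι (u⁻¹ : (ℤ√d)ˣ) - 1 := by rw [hv]; simp
      have e3 : (ι x)⁻¹ = ι v * t := by
        rw [ht]
        field_simp
      rw [e3, inv_eq_of_mul_eq_one_right e1]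
      clear_value t
      linear_combination (-t * ι (u⁻¹ : (ℤ√d)ˣ)) * e1 - ι u * t * e2
    · simp [map_entry]
    · simp [map_entry]
  have key : dia u * h * (dia u)⁻¹ = X' * k * Y' := by
    apply map_injective hι
    rw [map_mul, map_mul, map_mul, map_mul, map_inv, hX2, hY2, e]
    have := congrArg (SpecialLinearGroup.map ι) hXY
    rw [map_mul, map_mul, map_mul, map_mul, map_inv] at this
    calc _ = (SpecialLinearGroup.map ι (dia u) * up (ι x)⁻¹ * up t) * SpecialLinearGroup.map ι g *
          (SpecialLinearGroup.map ι (dia u) * up (ι x)⁻¹ * up t)⁻¹ := by rw [hk2]; group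
      _ = up t * (SpecialLinearGroup.map ι (dia u) * SpecialLinearGroup.map ι g *
          (SpecialLinearGroup.map ι (dia u))⁻¹) * (up t)⁻¹ := by rw [← hcomm]; group
      _ = _ := by rw [this, hk2]; group
  have := congrArg φ key
  rw [map_mul, map_mul, map_mul, map_mul, map_inv, hX1, hY1, one_mul, mul_one] at this
  rwa [mul_comm, inv_mul_cancel_left] at this

/-- Conjugation by `diag(x, x⁻¹)` over the field does not change the value of `φ`. -/
theorem map_eq_of_diag_conj {x : ℤ√d} (hx : x.norm ≠ 0)
    {h k : SpecialLinearGroup (Fin 2) (ℤ√d)} (hk : k ∈ cong ((m * x.norm : ℤ√d) ^ 8))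
    (h00 : h 0 0 = k 0 0) (h01 : h 0 1 = x ^ 2 * k 0 1) (h10 : x ^ 2 * h 1 0 = k 1 0)
    (h11 : h 1 1 = k 1 1) : φ h = φ k := by
  have hx0 : x ≠ 0 := by rintro rfl; simp at hx
  have hιx : ι x ≠ 0 := (map_ne_zero_iff ι hι).2 hx0
  set τ : SpecialLinearGroup (Fin 2) F := mk4 (ι x) 0 0 (ι x)⁻¹ (by simp [hιx]) with hτ
  have hτ' : τ = up (ι x) * wy * up (ι x)⁻¹ * (wy⁻¹ * up (ι x) * wy⁻¹) := by
    apply ext4 <;> simp [hτ, hιx]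
  have hh : SpecialLinearGroup.map ι h = τ * SpecialLinearGroup.map ι k * τ⁻¹ := by
    apply ext4
    · simp [hτ, map_entry, h00]
      field_simp
    · simp [hτ, map_entry, h01]
      ring
    · simp [hτ, map_entry, ← h10]
      field_simp
    · simp [hτ, map_entry, h11, hιx, mul_right_comm]
  set ρ : SpecialLinearGroup (Fin 2) (ℤ√d) := wy⁻¹ * up x * wy⁻¹ with hρ
  have hk3 : ρ * k * ρ⁻¹ ∈ cong ((m * x.norm : ℤ√d) ^ 8) :=
    Subgroup.Normal.conj_mem inferInstance _ hk _
  have hdvd : (1 : ℤ√d) * x ^ 2 ∣ (m * x.norm : ℤ√d) ^ 8 := by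
    rw [one_mul]
    exact (pow_dvd_pow_of_dvd ((dvd_norm x).mul_left _) 2).trans (pow_dvd_pow _ (by norm_num))
  obtain ⟨k4, -, hk4⟩ := exists_map_eq_up_conj (t := (ι x)⁻¹) (mul_inv_cancel₀ hιx)
    (cong_anti hdvd hk3)
  have h1 := map_eq_of_up_conj hι hd hm hm0 φ u hu hx hk3 hk4
  have h2 : h = up x * wy * k4 * (up x * wy)⁻¹ := by
    apply map_injective hι
    rw [hh, map_mul, map_mul, map_inv, map_mul, hk4, map_mul, map_mul, map_inv, map_up, map_wy,
      hτ', hρ, map_mul, map_mul, map_inv, map_up, map_wy]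
    group
  rw [h2, map_mul, map_inv, map_mul φ (up x * wy), mul_comm, inv_mul_cancel_left, h1, map_mul,
    map_inv,
    map_mul φ ρ, mul_comm, inv_mul_cancel_left]

end ConjugationInvariance

section Symbol

variable {S : Type*} [CommRing S] {A : Type*} [CommGroup A]

/-- The value of `φ` on some element of `P`, if there is one. -/
noncomputable def pick (φ : SpecialLinearGroup (Fin 2) S →* A)
    (P : Set (SpecialLinearGroup (Fin 2) S)) : A :=
  open Classical in if h : ∃ g, g ∈ P then φ h.choose else 1

/-- The value of `φ` on a matrix of `cong m` with first row `(a, m b)`, `b ≡ β` modulo `a`. -/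
noncomputable def symb (φ : SpecialLinearGroup (Fin 2) S →* A) (m a β : S) : A :=
  pick φ {g | g ∈ cong m ∧ g 0 0 = a ∧ a * m ∣ g 0 1 - m * β}

variable {φ : SpecialLinearGroup (Fin 2) S →* A} {m a : S}

theorem symb_eq (hφ : elem m ≤ φ.ker) {β : S} {g : SpecialLinearGroup (Fin 2) S} (hg : g ∈ cong m)
    (h0 : g 0 0 = a) (h1 : a * m ∣ g 0 1 - m * β) : symb φ m a β = φ g := by
  have h : ∃ g, g ∈ {g | g ∈ cong m ∧ g 0 0 = a ∧ a * m ∣ g 0 1 - m * β} := ⟨g, hg, h0, h1⟩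
  rw [symb, pick, dif_pos h]
  obtain ⟨hk, k0, k1⟩ := h.choose_spec
  set k := h.choose
  obtain ⟨r, hr⟩ := dvd_sub h1 k1
  have hup : up (m * r) ∈ elem m := up_mem_elem (dvd_mul_right _ _)
  obtain ⟨X, hX, e⟩ := exists_eq_lo_mul (g := k * up (m * r)) (h := g)
    (mul_mem hk (elem_le_cong _ hup)) hg (by simp [k0, h0])
    (by
      simp [k0]
      linear_combination -hr)
  have hX1 : φ X = 1 := hφ hX
  have hY1 : φ (up (m * r)) = 1 := hφ hup
  rw [e, map_mul, map_mul, hX1, hY1, one_mul, mul_one]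

theorem symb_congr {β β' : S} (h : a ∣ β - β') : symb φ m a β = symb φ m a β' := by
  have : ∀ g : SpecialLinearGroup (Fin 2) S,
      (a * m ∣ g 0 1 - m * β ↔ a * m ∣ g 0 1 - m * β') := by
    intro g
    obtain ⟨t, ht⟩ := h
    have e : g 0 1 - m * β' = g 0 1 - m * β + a * m * t := by linear_combination m * ht
    rw [e]
    exact (dvd_add_left (dvd_mul_right _ _)).symm
  have e : {g | g ∈ cong m ∧ g 0 0 = a ∧ a * m ∣ g 0 1 - m * β} =
      {g | g ∈ cong m ∧ g 0 0 = a ∧ a * m ∣ g 0 1 - m * β'} := by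
    ext g
    simp only [Set.mem_ofPred_eq, this g]
  rw [symb, symb, e]

theorem exists_mem_cong_row {s β : S} (hs : m ∣ s) (has : IsCoprime a s) (haβ : IsCoprime a β)
    (hma : m ∣ a - 1) : ∃ g : SpecialLinearGroup (Fin 2) S,
      g 0 0 = a ∧ a * m ∣ g 0 1 - m * β ∧ s ∣ g 0 1 ∧ s ∣ g 1 0 ∧ m ∣ g 1 1 - 1 := by
  obtain ⟨s', rfl⟩ := hs
  obtain ⟨x, y, hxy⟩ := has.of_mul_right_right
  have hay : IsCoprime a y := ⟨x, s', by linear_combination hxy⟩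
  obtain ⟨P, Q, hPQ⟩ := has.mul_right (has.mul_right (haβ.mul_right hay))
  refine ⟨mk4 a (m * s' * (β * y)) (-(Q * (m * s'))) P (by linear_combination hPQ), rfl,
    ⟨-(β * x), ?_⟩, dvd_mul_right _ _, ⟨-Q, ?_⟩, ?_⟩
  · simp only [mk4_01]
    linear_combination m * β * hxy
  · simp only [mk4_10]
    ring
  · obtain ⟨t, ht⟩ := hma
    refine ⟨-(t * P) - Q * s' * (m * s' * (β * y)), ?_⟩
    simp only [mk4_11]
    linear_combination hPQ - P * ht

theorem symb_eq_one (hφ : elem m ≤ φ.ker) {β : S} (h : a = 1 - m * β) : symb φ m a β = 1 := by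
  have hup : up (m * β) ∈ elem m := up_mem_elem (dvd_mul_right _ _)
  have h1 : φ (up (m * β)) = 1 := hφ hup
  rw [symb_eq hφ (g := lo 1 * up (m * β) * (lo 1)⁻¹)
    (Subgroup.Normal.conj_mem inferInstance _ (elem_le_cong _ hup) _)
    (by simp [h, sub_eq_add_neg]) (by simp)]
  rw [map_mul, map_mul, map_inv, h1, mul_one, mul_inv_cancel]

theorem symb_neg_eq_one (hφ : elem m ≤ φ.ker) {β : S} (h : a = 1 - m * β) :
    symb φ m a (-β) = 1 := by
  have hup : up (m * -β) ∈ elem m := up_mem_elem (dvd_mul_right _ _)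
  have h1 : φ (up (m * -β)) = 1 := hφ hup
  rw [symb_eq hφ (g := lo (-1) * up (m * -β) * (lo (-1))⁻¹)
    (Subgroup.Normal.conj_mem inferInstance _ (elem_le_cong _ hup) _)
    (by simp [h, sub_eq_add_neg]) (by simp)]
  rw [map_mul, map_mul, map_inv, h1, mul_one, mul_inv_cancel]

end Symbol

section CongruenceKernel

variable {d : ℤ} {F : Type*} [Field F] {ι : ℤ√d →+* F} {A : Type*} [CommGroup A]
variable (hι : Function.Injective ι) (hd : 0 < d) {m : ℤ} (hm : 8 * d ∣ m) (hm0 : m ≠ 0)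
  (φ : SpecialLinearGroup (Fin 2) (ℤ√d) →* A) (u : (ℤ√d)ˣ) (hu : (u : ℤ√d) * u - 1 ∣ m)
include hι hd hm hm0 hu

theorem symb_sq_mul {a : ℤ} (ha : m ^ 2 ∣ a - 1) (ha0 : ¬ IsUnit a) {x β β' : ℤ√d}
    (hx : IsCoprime (a : ℤ√d) x) (hβ : IsCoprime (a : ℤ√d) β) (hβ' : IsCoprime (a : ℤ√d) β') :
    symb φ (m : ℤ√d) a (x ^ 2 * β') * (symb φ (m : ℤ√d) a (x ^ 2 * β))⁻¹ =
      symb φ (m : ℤ√d) a β' * (symb φ (m : ℤ√d) a β)⁻¹ := by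
  have hφ : elem (m : ℤ√d) ≤ φ.ker := elem_le_ker φ u hu
  have hax : IsCoprime a x.norm := isCoprime_intCast_iff.1 hx
  have hxn : x.norm ≠ 0 := by
    intro h
    rw [h, isCoprime_zero_right] at hax
    exact ha0 hax
  have ham : IsCoprime a m := by
    obtain ⟨t, ht⟩ := ha
    exact ⟨1, -(m * t), by linear_combination ht⟩
  have hmS : (m : ℤ√d) ∣ (m * x.norm : ℤ√d) ^ 8 := dvd_pow (dvd_mul_right _ _) (by norm_num)
  have has : IsCoprime (a : ℤ√d) ((m * x.norm : ℤ√d) ^ 8) := by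
    have := ((ham.mul_right hax).pow_right (n := 8)).intCast (R := ℤ√d)
    exact_mod_cast this
  have hmx : x ^ 2 * m ∣ (m * x.norm : ℤ√d) ^ 8 := by
    refine Dvd.dvd.trans (mul_dvd_mul_right (pow_dvd_pow_of_dvd (dvd_norm x) 2) _) ?_
    exact ⟨m ^ 7 * (x.norm : ℤ√d) ^ 6, by ring⟩
  have hma : (m : ℤ√d) ∣ a - 1 := by
    have := (Zsqrtd.intCast_dvd_intCast (d := d) _ _).2 ((Dvd.intro_left _ (sq m).symm).trans ha)
    exact_mod_cast this
  have key : ∀ γ, IsCoprime (a : ℤ√d) γ → ∃ g G : SpecialLinearGroup (Fin 2) (ℤ√d),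
      symb φ (m : ℤ√d) a γ = φ g ∧ symb φ (m : ℤ√d) a (x ^ 2 * γ) = φ G ∧
      g 0 0 = a ∧ G 0 0 = a ∧ G 0 1 = x ^ 2 * g 0 1 ∧ x ^ 2 * G 1 0 = g 1 0 ∧ G 1 1 = g 1 1 ∧
      (m * x.norm : ℤ√d) ^ 8 ∣ g 0 1 ∧ (m * x.norm : ℤ√d) ^ 8 ∣ g 1 0 := by
    intro γ hγ
    obtain ⟨g, h00, h01, hs1, hs2, h11⟩ := exists_mem_cong_row hmS has hγ hma
    have hg : g ∈ cong (m : ℤ√d) :=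
      mem_cong.2 ⟨h00 ▸ hma, hmS.trans hs1, hmS.trans hs2, h11⟩
    obtain ⟨c, hc⟩ := hmx.trans hs2
    have hdet := det_eq g
    refine ⟨g, mk4 a (x ^ 2 * g 0 1) (m * c) (g 1 1) ?_, symb_eq hφ hg h00 h01,
      symb_eq hφ ?_ rfl ?_, h00, rfl, rfl, ?_, rfl, hs1, hs2⟩
    · rw [h00] at hdet
      linear_combination hdet + g 0 1 * hc
    · exact mem_cong.2 ⟨hma, (hmS.trans hs1).mul_left _, dvd_mul_right _ _, h11⟩
    · obtain ⟨t, ht⟩ := h01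
      exact ⟨x ^ 2 * t, by simp only [mk4_01]; linear_combination x ^ 2 * ht⟩
    · simp only [mk4_10]
      linear_combination -hc
  obtain ⟨g, G, e1, e2, h00, H00, H01, H10, H11, ⟨b, hb⟩, ⟨c, hc⟩⟩ := key β hβ
  obtain ⟨g', G', e1', e2', h00', H00', H01', H10', H11', ⟨b', hb'⟩, ⟨c', hc'⟩⟩ := key β' hβ'
  rw [e1, e2, e1', e2', ← map_inv, ← map_inv, ← map_mul, ← map_mul]
  have dg := det_eq g
  have dg' := det_eq g'
  set s := (m * x.norm : ℤ√d) ^ 8 with hs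
  rw [h00, hb, hc] at dg
  rw [h00', hb', hc'] at dg'
  refine map_eq_of_diag_conj hι hd hm hm0 φ u hu hxn (mem_cong.2 ⟨⟨s * (b * c) - s * b' * c, ?_⟩,
    ⟨a * b' - a * b, ?_⟩, ⟨c' * g 1 1 - g' 1 1 * c, ?_⟩, ⟨s * b' * c' - s * c' * b, ?_⟩⟩)
    ?_ ?_ ?_ ?_
  · simp [h00', hb', hc]
    linear_combination dg
  · simp [h00', hb', hb, h00]
    ring
  · simp [hc', hc]
    ring
  · simp [hc', hb, h00]
    linear_combination dg'
  · simp [H00', H01', H11, h00', ← H10]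
    ring
  · simp [H00', H01', H01, h00', H00, h00]
    ring
  · simp [H11', H11, ← H10, ← H10']
    ring
  · simp [H11', H01, h00, H00, ← H10']
    ring

theorem map_pow_eq_one {p e : ℕ} (hp : p.Prime) (hpe : p = 2 * e + 1) (he : Odd e)
    (hpm : m ^ 2 ∣ (p : ℤ) + 1) (hpd : 4 * d ∣ (p : ℤ) + 1)
    {g : SpecialLinearGroup (Fin 2) (ℤ√d)} (hg : g ∈ cong (m : ℤ√d)) {b : ℤ√d}
    (h00 : g 0 0 = -(p : ℤ√d)) (h01 : g 0 1 = m * b) (hb : (p : ℤ) ∣ b.norm ^ e - 1) :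
    φ g ^ e = 1 := by
  have hφ : elem (m : ℤ√d) ≤ φ.ker := elem_le_ker φ u hu
  obtain ⟨w, hw⟩ := hpm
  obtain ⟨f, hf⟩ := he
  set a : ℤ := -p with ha
  have haS : (a : ℤ√d) = -(p : ℤ√d) := by simp [ha]
  have ham2 : m ^ 2 ∣ a - 1 := ⟨-w, by rw [ha]; linear_combination -hw⟩
  have haU : ¬ IsUnit a := by
    rw [ha, IsUnit.neg_iff, Int.isUnit_iff]
    have := hp.two_le
    omega
  set β : ℤ√d := m * w with hβ
  have haβ : (a : ℤ√d) = 1 - m * β := by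
    have := congrArg (Int.cast : ℤ → ℤ√d) hw
    push_cast at this
    rw [haS, hβ]
    linear_combination -this
  have hcβ : IsCoprime (a : ℤ√d) β := ⟨1, m, by linear_combination haβ⟩
  have hcm : IsCoprime (a : ℤ√d) m := ⟨1, β, by linear_combination haβ⟩
  set Ψ : ℤ√d → A := symb φ (m : ℤ√d) a with hΨ
  have hΨ1 : Ψ β = 1 := symb_eq_one hφ haβ
  have hΨ2 : Ψ (-β) = 1 := symb_neg_eq_one hφ haβ
  have hcong : ∀ {x y : ℤ√d}, (a : ℤ√d) ∣ x - y → Ψ x = Ψ y := fun h ↦ symb_congr h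
  have hsq : ∀ {x y : ℤ√d}, IsCoprime (a : ℤ√d) x → IsCoprime (a : ℤ√d) y →
      Ψ (x ^ 2 * (y * β)) = Ψ (x ^ 2 * β) * Ψ (y * β) := by
    intro x y hx hy
    have := symb_sq_mul hι hd hm hm0 φ u hu ham2 haU hx hcβ (hy.mul_right hcβ)
    change Ψ _ * (Ψ _)⁻¹ = Ψ _ * (Ψ _)⁻¹ at this
    rw [hΨ1, inv_one, mul_one, mul_inv_eq_iff_eq_mul] at this
    rw [this, mul_comm]
  set c : ℤ√d := m * b with hc
  have hcn : (p : ℤ) ∣ c.norm ^ e - 1 := by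
    have h1 : c.norm ^ e = m ^ (2 * e) * b.norm ^ e := by
      rw [hc, Zsqrtd.norm_mul, Zsqrtd.norm_intCast, mul_pow, pow_mul, sq]
    have h2 : (p : ℤ) ∣ m ^ (2 * e) - 1 := by
      have hpm : IsCoprime m (p : ℤ) := ⟨m * w, -1, by linear_combination -hw⟩
      have := Int.ModEq.pow_card_sub_one_eq_one hp hpm
      rw [show p - 1 = 2 * e by omega] at this
      exact Int.modEq_iff_dvd.1 this.symm
    rw [h1]
    have e3 : m ^ (2 * e) * b.norm ^ e - 1 =
      (m ^ (2 * e) - 1) * b.norm ^ e + (b.norm ^ e - 1) := by ring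
    rw [e3]
    exact dvd_add (h2.mul_right _) hb
  have hpc := dvd_pow_sub_one_or_dvd_pow_add_one hp hpe (by omega)
    (dvd_pow_sub_one_of_four_mul_dvd hd hp hpe hpd) hcn
  have hap : ∀ {y : ℤ√d}, (p : ℤ√d) ∣ y → (a : ℤ√d) ∣ y := fun h ↦ by rwa [haS, neg_dvd]
  have hac : IsCoprime (a : ℤ√d) c := by
    have hd := det_eq g
    rw [h00, h01, ← haS] at hd
    exact ⟨g 1 1, -g 1 0, by linear_combination hd⟩
  have hg1 : Ψ (c * β) = φ g := by
    refine symb_eq hφ hg (h00.trans haS.symm) ⟨b, ?_⟩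
    rw [h01, haβ]
    ring
  set x : ℤ√d := c ^ f with hx
  have hax : IsCoprime (a : ℤ√d) x := hac.pow_right
  have hprod : Ψ (x ^ 2 * β) * φ g = 1 := by
    rw [← hg1, ← hsq hax hac]
    have e4 : x ^ 2 * (c * β) = c ^ e * β := by rw [hx, hf]; ring
    rw [e4]
    rcases hpc with h | h
    · rw [← hΨ1]
      refine hcong ?_
      rw [show c ^ e * β - β = (c ^ e - 1) * β by ring]
      exact (hap h).mul_right _
    · rw [← hΨ2]
      refine hcong ?_
      rw [show c ^ e * β - -β = (c ^ e + 1) * β by ring]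
      exact (hap h).mul_right _
  have hpow : ∀ n : ℕ, Ψ ((x ^ n) ^ 2 * β) = Ψ (x ^ 2 * β) ^ n := by
    intro n
    induction n with
    | zero => simpa using hΨ1
    | succ n ih =>
      rw [pow_succ (Ψ (x ^ 2 * β)), ← ih, mul_comm (Ψ ((x ^ n) ^ 2 * β)),
        ← hsq hax (hax.pow_right.pow_right)]
      congr 1
      ring
  have hone : Ψ (x ^ 2 * β) ^ e = 1 := by
    rw [← hpow, ← hΨ1]
    refine hcong ?_
    have e5 : (x ^ e) ^ 2 = ((c ^ e) ^ 2) ^ f := by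
      rw [hx]
      ring
    have h2 : (p : ℤ√d) ∣ (c ^ e) ^ 2 - 1 := by
      rw [show (c ^ e) ^ 2 - 1 = (c ^ e - 1) * (c ^ e + 1) by ring]
      rcases hpc with h | h
      · exact h.mul_right _
      · exact h.mul_left _
    rw [e5, ← sub_one_mul]
    refine Dvd.dvd.mul_right (hap (h2.trans ?_)) _
    simpa using sub_dvd_pow_sub_pow ((c ^ e) ^ 2) 1 f
  have := congrArg (· ^ e) hprod
  simpa [mul_pow, hone] using this

theorem map_eq_one_of_mem_cong {g : SpecialLinearGroup (Fin 2) (ℤ√d)}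
    (hg : g ∈ cong ((m : ℤ√d) ^ 2)) : φ g = 1 := by
  suffices h : φ g ∈ (⊥ : Subgroup A) from Subgroup.mem_bot.1 h
  refine mem_of_forall_prime fun l hl ↦ ?_
  obtain ⟨p, e, hp, hpe, he, hle, hp4d, hpm, Y, hY, b, h00, h01, hb⟩ :=
    exists_reduction hd hm hm0 hg hl
  refine ⟨e, hle, Subgroup.mem_bot.2 ?_⟩
  have hY1 : φ Y = 1 := elem_le_ker φ u hu hY
  have := map_pow_eq_one hι hd hm hm0 φ u hu hp hpe he hpm hp4d
    (mul_mem (cong_anti (Dvd.intro_left _ (sq _).symm) hg) (elem_le_cong _ hY)) h00 h01 hb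
  rwa [map_mul, hY1, mul_one] at this

end CongruenceKernel

theorem not_isSquare_of_squarefree {d : ℤ} (hd : 1 < d) (hs : Squarefree d) : ¬ IsSquare d := by
  rintro ⟨r, rfl⟩
  have := Int.isUnit_iff.1 (hs r dvd_rfl)
  rcases this with rfl | rfl <;> simp at hd

theorem exists_unit_and_level {d : ℤ} (hd : 1 < d) (hsq : ¬ IsSquare d) :
    ∃ (u : (ℤ√d)ˣ) (m : ℤ), m ≠ 0 ∧ 8 * d ∣ m ∧ (u : ℤ√d) * u - 1 ∣ m := by
  obtain ⟨x, y, hxy, hy⟩ := Pell.exists_of_not_isSquare (by omega : 0 < d) hsq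
  let u : (ℤ√d)ˣ := ⟨⟨x, y⟩, ⟨x, -y⟩,
    by ext <;> simp <;> first | ring1 | linear_combination hxy,
    by ext <;> simp <;> first | ring1 | linear_combination hxy⟩
  have hu : (u : ℤ√d) = ⟨x, y⟩ := rfl
  have hx : x ≠ 0 := by
    rintro rfl
    nlinarith [sq_nonneg y]
  have hne : (u : ℤ√d) * u - 1 ≠ 0 := by
    intro h
    have := congrArg Zsqrtd.im h
    simp [hu] at this
    rcases (by linarith : x * y = 0) |> mul_eq_zero.1 with h | h <;> contradiction
  have hn : ((u : ℤ√d) * u - 1).norm ≠ 0 := by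
    intro h
    refine hne ?_
    rw [Zsqrtd.norm_eq_zero (fun n hn ↦ hsq ⟨n, hn⟩)] at h
    exact h
  refine ⟨u, 8 * d * ((u : ℤ√d) * u - 1).norm, by positivity, dvd_mul_right _ _, ?_⟩
  push_cast
  exact (dvd_norm _).mul_left _

section Transfer

variable {K : Type*} [Field K] [NumberField K]

theorem exists_rat_add_mul {d : ℤ} (hsq : ¬ IsSquare d) (hK2 : Module.finrank ℚ K = 2) {α : K}
    (hα : α ^ 2 = (d : K)) (x : K) : ∃ p q : ℚ, x = p + q * α := by
  have hli : LinearIndependent ℚ ![1, α] := by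
    rw [LinearIndependent.pair_iff]
    intro s t hst
    rw [Rat.smul_def, Rat.smul_def, mul_one] at hst
    have ht : t = 0 := by
      by_contra ht
      have htK : (t : K) ≠ 0 := by exact_mod_cast ht
      have h2 : ((s / t : ℚ) : K) = -α := by
        push_cast
        field_simp
        linear_combination hst
      have h3 : (((s / t) ^ 2 : ℚ) : K) = ((d : ℚ) : K) := by
        push_cast at h2 ⊢
        rw [h2, ← hα]
        ring
      have h4 : (s / t) ^ 2 = (d : ℚ) := by exact_mod_cast h3
      exact hsq (Rat.isSquare_intCast_iff.1 ⟨s / t, by rw [← h4, sq]⟩)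
    subst ht
    simpa using hst
  have hsp := hli.span_eq_top_of_card_eq_finrank' (by simp [hK2])
  have hx : x ∈ Submodule.span ℚ (Set.range ![1, α]) := hsp ▸ Submodule.mem_top
  rw [Matrix.range_cons, Matrix.range_cons, Matrix.range_empty, Set.union_empty,
    Set.singleton_union, Submodule.mem_span_pair] at hx
  obtain ⟨p, q, rfl⟩ := hx
  exact ⟨p, q, by simp [Rat.smul_def]⟩

theorem exists_mul_mem_range {d : ℤ} (hsq : ¬ IsSquare d) (hK2 : Module.finrank ℚ K = 2) {α : 𝓞 K}
    (hα : α ^ 2 = (d : 𝓞 K)) (j : ℤ√d →+* 𝓞 K) (hj : j Zsqrtd.sqrtd = α) :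
    ∃ k : ℤ, k ≠ 0 ∧ ∀ r : 𝓞 K, ∃ s, j s = k * r := by
  have hpt : ∀ r : 𝓞 K, ∃ n : ℤ, n ≠ 0 ∧ ∃ s, j s = n * r := by
    intro r
    obtain ⟨p, q, hpq⟩ := exists_rat_add_mul hsq hK2 (α := (α : K))
      (by simpa using congrArg (algebraMap (𝓞 K) K) hα) (r : K)
    refine ⟨p.den * q.den, by positivity, ⟨p.num * q.den, q.num * p.den⟩, ?_⟩
    have hp : (p.num : K) = p * p.den := 
      by exact_mod_cast congrArg (Rat.cast (K := K)) (Rat.mul_den_eq_num p).symm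
    have hq : (q.num : K) = q * q.den := 
      by exact_mod_cast congrArg (Rat.cast (K := K)) (Rat.mul_den_eq_num q).symm
    apply RingOfIntegers.ext
    rw [Zsqrtd.decompose, map_add, map_mul, hj, map_intCast, map_intCast]
    simp
    rw [hp, hq]
    linear_combination -(p.den * q.den : K) * hpq
  let b := RingOfIntegers.basis K
  choose n hn s hs using hpt
  refine ⟨∏ i, n (b i), Finset.prod_ne_zero_iff.2 fun i _ ↦ hn _, fun r ↦ ?_⟩
  rw [← RingHom.mem_range, ← b.sum_repr r, Finset.mul_sum]
  refine sum_mem fun i _ ↦ ?_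
  rw [zsmul_eq_mul, ← Finset.prod_erase_mul _ _ (Finset.mem_univ i)]
  refine ⟨((b.repr r i * ∏ x ∈ Finset.univ.erase i, n (b x) : ℤ) : ℤ√d) * s (b i), ?_⟩
  rw [map_mul, hs, map_intCast]
  push_cast
  ring

theorem exists_cong_le_ker {d : ℤ} (hd : 1 < d) (hdsf : Squarefree d)
    (hK2 : Module.finrank ℚ K = 2) {α : K} (hα : α ^ 2 = (d : K)) {A : Type*} [CommGroup A]
    (φ : SpecialLinearGroup (Fin 2) (𝓞 K) →* A) :
    ∃ N : ℤ, N ≠ 0 ∧ cong (N : 𝓞 K) ≤ φ.ker := by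
  have hsq := not_isSquare_of_squarefree hd hdsf
  obtain ⟨u, m, hm0, hmd, hu⟩ := exists_unit_and_level hd hsq
  have hint : IsIntegral ℤ α := by
    refine IsIntegral.of_pow two_pos ?_
    rw [hα]
    exact isIntegral_algebraMap (R := ℤ) (x := d)
  let a : 𝓞 K := ⟨α, hint⟩
  have ha : a * a = (d : 𝓞 K) := by
    apply RingOfIntegers.ext
    have : (a : K) = α := rfl
    simp [this, ← sq, hα]
  let j : ℤ√d →+* 𝓞 K := Zsqrtd.lift ⟨a, ha⟩
  have hj : j Zsqrtd.sqrtd = a := by simp [j]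
  have hji : Function.Injective j := Zsqrtd.lift_injective _ fun n hn ↦ hsq ⟨n, hn⟩
  obtain ⟨k, hk0, hk⟩ := exists_mul_mem_range hsq hK2 (by rw [sq, ha]) j hj
  refine ⟨k * m ^ 2, by positivity, fun g hg ↦ ?_⟩
  obtain ⟨⟨r0, h0⟩, ⟨r1, h1⟩, ⟨r2, h2⟩, ⟨r3, h3⟩⟩ := mem_cong.1 hg
  obtain ⟨s0, e0⟩ := hk r0
  obtain ⟨s1, e1⟩ := hk r1
  obtain ⟨s2, e2⟩ := hk r2
  obtain ⟨s3, e3⟩ := hk r3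
  push_cast at h0 h1 h2 h3
  have f0 : j (1 + m ^ 2 * s0) = g 0 0 := by simp; linear_combination m ^ 2 * e0 - h0
  have f1 : j (m ^ 2 * s1) = g 0 1 := by simp; linear_combination m ^ 2 * e1 - h1
  have f2 : j (m ^ 2 * s2) = g 1 0 := by simp; linear_combination m ^ 2 * e2 - h2
  have f3 : j (1 + m ^ 2 * s3) = g 1 1 := by simp; linear_combination m ^ 2 * e3 - h3
  let h : SpecialLinearGroup (Fin 2) (ℤ√d) :=
    mk4 (1 + m ^ 2 * s0) (m ^ 2 * s1) (m ^ 2 * s2) (1 + m ^ 2 * s3) (by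
      apply hji
      rw [map_sub, map_mul, map_mul, f0, f1, f2, f3, map_one, det_eq])
  have hgh : SpecialLinearGroup.map j h = g := by
    apply ext4
    · exact f0
    · exact f1
    · exact f2
    · exact f3
  have hh : h ∈ cong ((m : ℤ√d) ^ 2) := mem_cong.2
    ⟨⟨s0, by simp [h]⟩, ⟨s1, by simp [h]⟩, ⟨s2, by simp [h]⟩, ⟨s3, by simp [h]⟩⟩
  have := map_eq_one_of_mem_cong (ι := (algebraMap (𝓞 K) K).comp j)
    (RingOfIntegers.coe_injective.comp hji) (by omega) hmd hm0
    (φ.comp (SpecialLinearGroup.map j)) u hu hh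
  rwa [MonoidHom.comp_apply, hgh] at this

end Transfer

section StableRange

variable {R : Type*} [CommRing R]

theorem isCoprime_of_forall_isMaximal {x y : R}
    (h : ∀ M : Ideal R, M.IsMaximal → y ∈ M → x ∉ M) : IsCoprime x y := by
  rw [← Ideal.isCoprime_span_singleton_iff, Ideal.isCoprime_iff_sup_eq]
  by_contra hne
  obtain ⟨M, hM, hle⟩ := Ideal.exists_le_maximal _ hne
  rw [sup_le_iff, Ideal.span_singleton_le_iff_mem, Ideal.span_singleton_le_iff_mem] at hle
  exact h M hM hle.2 hle.1

theorem isCoprime_of_isMaximal_span {x y : R} (hy : (Ideal.span {y}).IsMaximal)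
    (hx : x ∉ Ideal.span {y}) : IsCoprime x y := by
  refine isCoprime_of_forall_isMaximal fun M hM hyM hxM ↦ hx ?_
  rwa [hy.eq_of_le hM.ne_top ((Ideal.span_singleton_le_iff_mem _).2 hyM)]

theorem exists_isCoprime_add_mul_of_ne_zero [IsDedekindDomain R] {a b N : R} (hab : IsCoprime a b)
    (hN : N ≠ 0) : ∃ r, IsCoprime (a + b * r) N := by
  classical
  have hI : Ideal.span {N} ≠ 0 := by simpa using hN
  obtain ⟨c, hc⟩ := IsDedekindDomain.exists_forall_sub_mem_ideal
    (s := (Ideal.finite_factors hI).toFinset) (fun v ↦ v.asIdeal) (fun _ ↦ 1)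
    (fun v _ ↦ v.prime)
    (fun i _ j _ hij h ↦ hij (IsDedekindDomain.HeightOneSpectrum.ext h))
    (fun v ↦ if a ∈ v.1.asIdeal then 1 else 0)
  refine ⟨c, isCoprime_of_forall_isMaximal fun M hM hNM h ↦ ?_⟩
  have hM0 : M ≠ ⊥ := by
    rintro rfl
    exact hN (by simpa using hNM)
  have := hc ⟨M, hM.isPrime, hM0⟩ (by
    simpa [Ideal.dvd_span_singleton] using hNM)
  simp only [pow_one] at this
  split_ifs at this with ha
  · have hb : b * c ∈ M := (M.add_mem_iff_right ha).1 h
    rcases hM.isPrime.mem_or_mem hb with hb | hb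
    · obtain ⟨x, y, hxy⟩ := hab
      refine hM.ne_top ((Ideal.eq_top_iff_one _).2 (hxy ▸ ?_))
      exact M.add_mem (M.mul_mem_left _ ha) (M.mul_mem_left _ hb)
    · refine hM.ne_top ((Ideal.eq_top_iff_one _).2 ?_)
      simpa using M.sub_mem hb this
  · rw [sub_zero] at this
    exact ha ((M.add_mem_iff_left (M.mul_mem_left b this)).1 h)

end StableRange

section Level

variable {R : Type*} [CommRing R] {A : Type*} [CommGroup A]

theorem map_eq_of_dvd_sub {φ : SpecialLinearGroup (Fin 2) R →* A} {N : R} (hφ : cong N ≤ φ.ker)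
    {g h : SpecialLinearGroup (Fin 2) R} (h00 : N ∣ g 0 0 - h 0 0) (h01 : N ∣ g 0 1 - h 0 1)
    (h10 : N ∣ g 1 0 - h 1 0) (h11 : N ∣ g 1 1 - h 1 1) : φ g = φ h := by
  have hmem : g * h⁻¹ ∈ cong N := by
    have hdet := det_eq h
    obtain ⟨a, ha⟩ := h00
    obtain ⟨b, hb⟩ := h01
    obtain ⟨c, hc⟩ := h10
    obtain ⟨e, he⟩ := h11
    refine mem_cong.2 ⟨⟨a * h 1 1 - b * h 1 0, ?_⟩, ⟨b * h 0 0 - a * h 0 1, ?_⟩,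
      ⟨c * h 1 1 - e * h 1 0, ?_⟩, ⟨e * h 0 0 - c * h 0 1, ?_⟩⟩
    · simp only [mul00, inv00, inv10]
      linear_combination h 1 1 * ha - h 1 0 * hb + hdet
    · simp only [mul01, inv01, inv11]
      linear_combination h 0 0 * hb - h 0 1 * ha
    · simp only [mul10, inv00, inv10]
      linear_combination h 1 1 * hc - h 1 0 * he
    · simp only [mul11, inv01, inv11]
      linear_combination h 0 0 * he - h 0 1 * hc + hdet
  have : φ (g * h⁻¹) = 1 := hφ hmem
  rwa [map_mul, map_inv, mul_inv_eq_one] at this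

variable (φ : SpecialLinearGroup (Fin 2) R →* A)

theorem map_lo_eq (x : R) : φ (lo x) = φ (up (-x)) := by
  rw [lo_eq_conj, map_mul, map_mul, map_inv, mul_inv_cancel_comm]

/-- The largest ideal `I` such that `φ` is trivial on upper unipotent matrices over `I`. -/
def levelIdeal : Ideal R where
  carrier := {x | ∀ r, φ (up (r * x)) = 1}
  zero_mem' r := by rw [mul_zero, up_zero, map_one]
  add_mem' {x y} hx hy r := by rw [mul_add, up_add, map_mul, hx r, hy r, one_mul]
  smul_mem' c x hx r := by rw [smul_eq_mul, ← mul_assoc, hx]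

variable {φ} {N : R} (hφ : cong N ≤ φ.ker)
include hφ

theorem level_mem_levelIdeal : N ∈ levelIdeal φ := fun _ ↦
  hφ (elem_le_cong _ (up_mem_elem (dvd_mul_left _ _)))

theorem sq_sub_one_mem_levelIdeal {v : R} (hv : IsCoprime v N) : v ^ 2 - 1 ∈ levelIdeal φ := by
  obtain ⟨w, n, h⟩ := hv
  intro r
  have key : φ (mk4 (2 * v - v ^ 2 * w) (-(1 - v * w)) (1 - v * w) w (by ring) * up r) =
      φ (up (v ^ 2 * r) * mk4 (2 * v - v ^ 2 * w) (-(1 - v * w)) (1 - v * w) w (by ring)) := by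
    refine map_eq_of_dvd_sub hφ ⟨-n * v ^ 2 * r, ?_⟩ ⟨2 * n * v * r, ?_⟩ ⟨0, ?_⟩ ⟨n * r, ?_⟩
    · simp
      linear_combination -v ^ 2 * r * h
    · simp
      linear_combination -2 * v * r * h
    · simp
    · simp
      linear_combination -r * h
  rw [map_mul, map_mul, mul_comm, mul_left_inj] at key
  rw [show r * (v ^ 2 - 1) = v ^ 2 * r + -r by ring, up_add, map_mul, ← key, ← map_mul, ← up_add,
    add_neg_cancel, up_zero, map_one]

theorem exists_map_up_eq [IsDedekindDomain R] (hN : N ≠ 0) (g : SpecialLinearGroup (Fin 2) R) :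
    ∃ x, φ (up x) = φ g := by
  have hab : IsCoprime (g 0 0) (g 0 1) := ⟨g 1 1, -g 1 0, by linear_combination det_eq g⟩
  obtain ⟨r, v, n, hv⟩ := exists_isCoprime_add_mul_of_ne_zero hab hN
  have hred : ∀ h : SpecialLinearGroup (Fin 2) R, N ∣ h 0 0 - 1 → ∃ x, φ (up x) = φ h := by
    rintro h ⟨s, hs⟩
    refine ⟨-h 1 0 + h 0 1, ?_⟩
    rw [up_add, map_mul, ← map_lo_eq, ← map_mul]
    symm
    refine map_eq_of_dvd_sub hφ ⟨s, ?_⟩ ⟨0, ?_⟩ ⟨0, ?_⟩ ⟨-s * h 1 1, ?_⟩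
    · simp [hs]
    · simp
    · simp
    · simp
      linear_combination det_eq h - h 1 1 * hs
  set a := g 0 0 + g 0 1 * r with ha
  obtain ⟨x, hx⟩ := hred (g * lo r * up (v * (1 - g 0 1)) * lo (1 - a))
    ⟨-n * (1 - g 0 1) * (1 - a), by
      simp [← ha]
      linear_combination (1 - g 0 1) * (1 - a) * hv⟩
  refine ⟨x + (1 - a) + -(v * (1 - g 0 1)) + r, ?_⟩
  rw [map_mul, map_mul, map_mul, map_lo_eq, map_lo_eq] at hx
  rw [up_add, up_add, up_add, map_mul, map_mul, map_mul, hx]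
  simp only [← map_mul, mul_assoc, ← up_add]
  rw [show -r + v * (1 - g 0 1) + -(1 - a) + (1 - a) + -(v * (1 - g 0 1)) + r = 0 by ring,
    up_zero, mul_one]

end Level

section Exponent

theorem up_mul_natCast {R : Type*} [CommRing R] (x : R) (n : ℕ) : up (x * n) = up x ^ n := by
  induction n with
  | zero => rw [Nat.cast_zero, mul_zero, up_zero, pow_zero]
  | succ n ih => rw [Nat.cast_succ, mul_add, mul_one, up_add, ih, pow_succ]

theorem twentyFour_mem_levelIdeal {R : Type*} [CommRing R] {A : Type*} [CommGroup A]
    {φ : SpecialLinearGroup (Fin 2) R →* A} {N : ℕ} (hN : N ≠ 0) (hφ : cong (N : R) ≤ φ.ker) :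
    ((24 : ℕ) : R) ∈ levelIdeal φ := by
  obtain ⟨k, M, hM, hNM⟩ := Nat.exists_eq_pow_mul_and_not_dvd hN 2 (by norm_num)
  have hcop : IsCoprime ((2 : ℤ) ^ (k + 1)) (M : ℤ) := by
    have := (Nat.Prime.coprime_iff_not_dvd Nat.prime_two).2 hM
    exact_mod_cast Nat.isCoprime_iff_coprime.2 (this.pow_left (k + 1))
  obtain ⟨x, y, hxy⟩ := hcop
  obtain ⟨v, hv⟩ : ∃ v : ℤ, v = 2 + y * M := ⟨_, rfl⟩
  have hv2 : IsCoprime v 2 := ⟨1, -(1 - x * 2 ^ k), by rw [hv]; linear_combination hxy⟩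
  have hvM : IsCoprime v (M : ℤ) :=
    ⟨x * 2 ^ k, y - x * 2 ^ k * y, by rw [hv]; linear_combination hxy⟩
  have hvN : IsCoprime v (N : ℤ) := by
    rw [hNM]
    push_cast
    exact hv2.pow_right.mul_right hvM
  have h1 := sq_sub_one_mem_levelIdeal hφ (by exact_mod_cast hvN.intCast (R := R))
  have h2 := level_mem_levelIdeal hφ
  have h3 : (24 : ℤ) = -2 * x * y * (v + 2) * (v + 3) * N - (v ^ 2 - 12) * (v ^ 2 - 1) := by
    have hNM' : (N : ℤ) = 2 ^ k * M := by exact_mod_cast hNM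
    rw [hNM']
    have e1 : y * M = v - 2 := by rw [hv]; ring
    have e2 : x * 2 ^ (k + 1) = 3 - v := by rw [hv]; linear_combination hxy
    linear_combination (v + 2) * (v + 3) * (x * 2 ^ (k + 1) * e1 + (v - 2) * e2)
  have h4 := congrArg (Int.cast : ℤ → R) h3
  push_cast at h4
  push_cast
  rw [h4]
  exact sub_mem (Ideal.mul_mem_left _ _ h2) (Ideal.mul_mem_left _ _ h1)

end Exponent

section Finiteness

variable {R : Type*} [CommRing R] {A : Type*} [CommGroup A]
  {φ : SpecialLinearGroup (Fin 2) R →* A} (hs : ∀ a, ∃ x, φ (up x) = a)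
include hs

theorem pow_eq_one_of_natCast_mem {n : ℕ} (hn : (n : R) ∈ levelIdeal φ) (a : A) : a ^ n = 1 := by
  obtain ⟨x, rfl⟩ := hs a
  rw [← map_pow, ← up_mul_natCast]
  exact hn x

theorem finite_of_finite_quotient [Finite (R ⧸ levelIdeal φ)] : Finite A := by
  refine Finite.of_surjective (fun q : R ⧸ levelIdeal φ ↦ φ (up q.out)) fun a ↦ ?_
  obtain ⟨x, rfl⟩ := hs a
  refine ⟨Ideal.Quotient.mk _ x, ?_⟩
  have h : (Ideal.Quotient.mk (levelIdeal φ) x).out - x ∈ levelIdeal φ := by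
    rw [← Ideal.Quotient.eq]
    exact Quotient.out_eq _
  have := h 1
  rw [one_mul, sub_eq_add_neg, up_add, map_mul, ← up_inv, map_inv, mul_inv_eq_one] at this
  exact this

end Finiteness

section Inert

variable {K : Type*} [Field K] [NumberField K]

theorem exists_sq_sub_one_notMem (hK2 : Module.finrank ℚ K = 2) {q : ℕ} (hq : q.Prime)
    (hp : (Ideal.span {(q : 𝓞 K)}).IsPrime) :
    ∃ w : 𝓞 K, w ∉ Ideal.span {(q : 𝓞 K)} ∧ w ^ 2 - 1 ∉ Ideal.span {(q : 𝓞 K)} := by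
  by_contra! H
  have hcard : Nat.card (𝓞 K ⧸ Ideal.span {(q : 𝓞 K)}) = q ^ 2 := by
    have := Ideal.absNorm_span_natCast (S := 𝓞 K) q
    rwa [RingOfIntegers.rank, hK2, Ideal.absNorm_apply, Submodule.cardQuot_apply] at this
  have hle : Nat.card (𝓞 K ⧸ Ideal.span {(q : 𝓞 K)}) ≤ 3 := by
    classical
    have huniv : (Set.univ : Set (𝓞 K ⧸ Ideal.span {(q : 𝓞 K)})) ⊆
        (({0, 1, -1} : Finset (𝓞 K ⧸ Ideal.span {(q : 𝓞 K)})) : Set _) := by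
      intro z _
      obtain ⟨w, rfl⟩ := Ideal.Quotient.mk_surjective z
      by_cases hw : w ∈ Ideal.span {(q : 𝓞 K)}
      · simp [Ideal.Quotient.eq_zero_iff_mem.2 hw]
      · have h2 := Ideal.Quotient.eq_zero_iff_mem.2 (H w hw)
        rw [map_sub, map_pow, map_one] at h2
        rcases sq_eq_one_iff.1 (sub_eq_zero.1 h2) with h | h <;> simp [h]
    rw [← Set.ncard_univ]
    refine (Set.ncard_le_ncard huniv (Finset.finite_toSet _)).trans ?_
    rw [Set.ncard_coe_finset]
    exact Finset.card_le_three
  have := hq.two_le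
  nlinarith

theorem exists_not_dvd_mem_levelIdeal (hK2 : Module.finrank ℚ K = 2) {A : Type*} [CommGroup A]
    {φ : SpecialLinearGroup (Fin 2) (𝓞 K) →* A} {N : ℕ} (hN : N ≠ 0)
    (hφ : cong (N : 𝓞 K) ≤ φ.ker) {q : ℕ} (hq : q.Prime)
    (hp : (Ideal.span {(q : 𝓞 K)}).IsPrime) :
    ∃ n : ℕ, ¬ q ∣ n ∧ (n : 𝓞 K) ∈ levelIdeal φ := by
  obtain ⟨w, hw, hw2⟩ := exists_sq_sub_one_notMem hK2 hq hp
  have hmax : (Ideal.span {(q : 𝓞 K)}).IsMaximal :=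
    hp.isMaximal (by simpa using hq.ne_zero)
  obtain ⟨k, M, hM, hNM⟩ := Nat.exists_eq_pow_mul_and_not_dvd hN q hq.ne_one
  have hcop : IsCoprime (q : 𝓞 K) (M : 𝓞 K) := by
    have := Nat.isCoprime_iff_coprime.2 ((Nat.Prime.coprime_iff_not_dvd hq).2 hM)
    exact_mod_cast this.intCast (R := 𝓞 K)
  obtain ⟨x, y, hxy⟩ := hcop
  set v : 𝓞 K := 1 + y * M * (w - 1) with hv
  have hvw : v = w + x * (1 - w) * q := by rw [hv]; linear_combination (w - 1) * hxy
  have hvq : v ∉ Ideal.span {(q : 𝓞 K)} := by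
    rw [Ideal.mem_span_singleton] at hw ⊢
    rwa [hvw, dvd_add_left (dvd_mul_left _ _)]
  have hv2 : v ^ 2 - 1 ∉ Ideal.span {(q : 𝓞 K)} := by
    rw [Ideal.mem_span_singleton] at hw2 ⊢
    have e : v ^ 2 - 1 = w ^ 2 - 1 + (v + w) * x * (1 - w) * q := by
      linear_combination (v + w) * hvw
    rwa [e, dvd_add_left (dvd_mul_left _ _)]
  have hvN : IsCoprime v (N : 𝓞 K) := by
    rw [hNM]
    push_cast
    exact (isCoprime_of_isMaximal_span hmax hvq).pow_right.mul_right
      ⟨1, -(y * (w - 1)), by rw [hv]; ring⟩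
  obtain ⟨s, t, hst⟩ := (isCoprime_of_isMaximal_span hmax hv2).pow_right (n := k)
  refine ⟨M, hM, ?_⟩
  have e : (M : 𝓞 K) = s * M * (v ^ 2 - 1) + t * N := by
    rw [hNM]
    push_cast
    linear_combination -(M : 𝓞 K) * hst
  rw [e]
  exact add_mem (Ideal.mul_mem_left _ _ (sq_sub_one_mem_levelIdeal hφ hvN))
    (Ideal.mul_mem_left _ _ (level_mem_levelIdeal hφ))

end Inert

theorem exists_eq_two_pow_mul_three_pow {n : ℕ} (hn : n ≠ 0)
    (h : ∀ q : ℕ, q.Prime → q ∣ n → q = 2 ∨ q = 3) : ∃ a b : ℕ, n = 2 ^ a * 3 ^ b := by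
  refine ⟨n.factorization 2, n.factorization 3, ?_⟩
  have hsub : n.factorization.support ⊆ {2, 3} := fun q hq ↦ by
    rw [Nat.support_factorization, Nat.mem_primeFactors] at hq
    simpa using h q hq.1 hq.2.1
  conv_lhs => rw [← Nat.prod_factorization_pow_eq_self hn]
  rw [Finsupp.prod_of_support_subset _ hsub _ (by simp), Finset.prod_pair (by norm_num)]

end SL2

/-- **Proposition 7.2.** Let `d > 1` be a squarefree integer, `𝓞` the ring of integers of
the real quadratic field `K = ℚ(√d)`, and `G = PSL(2, 𝓞)`.  Then the abelianization
`G/[G,G]` is finite, every rational prime `q` dividing `|G/[G,G]|` is ramified or split in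
`𝓞` and satisfies `q ∈ {2, 3}`; in particular `|G/[G,G]| = 2^a·3^b` for some naturals
`a, b`. -/
theorem real_quadratic_psl_abelianization
    (d : ℤ) (hd : 1 < d) (hdsf : Squarefree d)
    (hK2 : Module.finrank ℚ K = 2) (α : K) (hα : α ^ 2 = (d : K)) :
    Finite (Abelianization (PSL K)) ∧
      (∀ q : ℕ, q.Prime → q ∣ Nat.card (Abelianization (PSL K)) →
        (Ramified K q ∨ Split K q) ∧ (q = 2 ∨ q = 3)) ∧
      ∃ a b : ℕ, Nat.card (Abelianization (PSL K)) = 2 ^ a * 3 ^ b := by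
  obtain ⟨N, hN, hker⟩ := SL2.exists_cong_le_ker hd hdsf hK2 hα
    (Abelianization.of.comp (proj K))
  set φ := Abelianization.of.comp (proj K) with hφ
  have hφs : Function.Surjective φ :=
    (QuotientGroup.mk'_surjective (commutator (PSL K))).comp (QuotientGroup.mk'_surjective (PM K))
  have hN' : N.natAbs ≠ 0 := Int.natAbs_ne_zero.2 hN
  have hker' : SL2.cong (N.natAbs : 𝓞 K) ≤ φ.ker := by
    refine (SL2.cong_anti ?_).trans hker
    have h := map_dvd (Int.castRingHom (𝓞 K)) (Int.dvd_natAbs_self (a := N))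
    rwa [eq_intCast, eq_intCast, Int.cast_natCast] at h
  have hs : ∀ a, ∃ x, φ (SL2.up x) = a := fun a ↦ by
    obtain ⟨g, rfl⟩ := hφs a
    exact SL2.exists_map_up_eq hker' (by exact_mod_cast hN') g
  have h24 := SL2.twentyFour_mem_levelIdeal hN' hker'
  have hfq : Finite (𝓞 K ⧸ SL2.levelIdeal φ) := by
    refine Ideal.finiteQuotientOfFreeOfNeBot _ fun h ↦ ?_
    rw [h, Ideal.mem_bot] at h24
    exact absurd h24 (by norm_num)
  have hfin : Finite (Abelianization (PSL K)) := SL2.finite_of_finite_quotient hs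
  have hdvd : ∀ q : ℕ, q.Prime → q ∣ Nat.card (Abelianization (PSL K)) → ∀ n : ℕ,
      (n : 𝓞 K) ∈ SL2.levelIdeal φ → q ∣ n := by
    intro q hq hqc n hn
    have : Fact q.Prime := ⟨hq⟩
    obtain ⟨x, hx⟩ := exists_prime_orderOf_dvd_card' q hqc
    rw [← hx]
    exact orderOf_dvd_of_pow_eq_one (SL2.pow_eq_one_of_natCast_mem hs hn x)
  have h23 : ∀ q : ℕ, q.Prime → q ∣ Nat.card (Abelianization (PSL K)) → q = 2 ∨ q = 3 := by
    intro q hq hqc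
    have h := hdvd q hq hqc 24 h24
    rw [show 24 = 2 ^ 3 * 3 by norm_num, hq.dvd_mul] at h
    exact h.imp (fun h ↦ (Nat.prime_dvd_prime_iff_eq hq Nat.prime_two).1 (hq.dvd_of_dvd_pow h))
      (Nat.prime_dvd_prime_iff_eq hq Nat.prime_three).1
  refine ⟨hfin, fun q hq hqc ↦ ⟨?_, h23 q hq hqc⟩,
    SL2.exists_eq_two_pow_mul_three_pow Nat.card_pos.ne' h23⟩
  by_contra hns
  rw [Ramified, Split] at hns
  have hp : (Ideal.span {(q : 𝓞 K)}).IsPrime := by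
    by_contra hp
    exact hns (or_iff_not_imp_left.2 fun h ↦ ⟨not_not.1 h, hp⟩)
  obtain ⟨n, hqn, hn⟩ := SL2.exists_not_dvd_mem_levelIdeal hK2 hN' hker' hq hp
  exact hqn (hdvd q hq hqc n hn)
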